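/- arXiv:1805.10452 — 2 statements merged into one kernel-verified Lean document; each statement's English description precedes it below -/
import Mathlib

section
/- Let F be a finite field of characteristic p and order q, and let d be an invertible exponent over F such that the Weil spectrum {W_{F,d}(a) : a ∈ F, a ≠ 0} has exactly three distinct elements. Then there exists a ∈ F with a ≠ 0 such that W_{F,d}(a) = 0. -/
open scoped BigOperators

/-- The canonical additive character of a finite field `F` of characteristic `p`:
`ψ(x) = exp(2πi·Tr(x)/p)`, where `Tr` is the absolute trace from `F` to `𝔽_p = ZMod p`. -/
noncomputable def canonicalPsi (F : Type*) [Field F] [Fintype F] (p : ℕ) [CharP F p]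
    (x : F) : ℂ :=
  letI : Algebra (ZMod p) F := ZMod.algebra F p
  Complex.exp (2 * Real.pi * Complex.I * ((Algebra.trace (ZMod p) F x).val : ℂ) / (p : ℂ))

/-- The Weil sum `W_{F,d}(a) = ∑_{x ∈ F} ψ(x^d − a·x)`. -/
noncomputable def weilSum (F : Type*) [Field F] [Fintype F] (p : ℕ) [CharP F p]
    (d : ℕ) (a : F) : ℂ :=
  ∑ x : F, canonicalPsi F p (x ^ d - a * x)

section Moments

open Finset

variable {F R : Type*} [Field F] [Fintype F] [CommRing R]

/-- The Weil sum of `x ^ d - a * x` attached to an arbitrary additive character. -/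
def binomialSum (ψ : AddChar F R) (d : ℕ) (a : F) : R := ∑ x : F, ψ (x ^ d - a * x)

/-- In a finite field, an exponent prime to the order of the unit group is a bijection. -/
theorem pow_bijective_of_gcd {d : ℕ} (hd : 0 < d)
    (hgcd : Nat.gcd d (Fintype.card F - 1) = 1) : Function.Bijective fun x : F => x ^ d := by
  classical
  refine Finite.injective_iff_bijective.mp fun x y hxy => ?_
  replace hxy : x ^ d = y ^ d := hxy
  by_cases hx : x = 0
  · subst hx
    rw [zero_pow hd.ne'] at hxy
    exact (pow_eq_zero_iff hd.ne').mp hxy.symm |>.symm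
  by_cases hy : y = 0
  · subst hy
    rw [zero_pow hd.ne'] at hxy
    exact (pow_eq_zero_iff hd.ne').mp hxy
  have hcop : (Nat.card Fˣ).Coprime d := by
    rw [Nat.card_units, Nat.card_eq_fintype_card]
    exact (Nat.coprime_comm.mp hgcd)
  have := (powCoprime hcop).injective (a₁ := Units.mk0 x hx) (a₂ := Units.mk0 y hy) (by
    ext; simpa using hxy)
  simpa using congrArg Units.val this

theorem neg_pow_of_gcd {d : ℕ} (hgcd : Nat.gcd d (Fintype.card F - 1) = 1) (x : F) :
    (-x) ^ d = -x ^ d := by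
  rcases Nat.even_or_odd d with h | h
  · have hodd : Odd (Fintype.card F - 1) := by
      by_contra hne
      have := Nat.dvd_gcd h.two_dvd (Nat.not_odd_iff_even.mp hne).two_dvd
      omega
    have h2 : (-1 : F) = 1 := by
      have := FiniteField.pow_card_sub_one_eq_one (-1 : F) (by simp)
      rwa [hodd.neg_one_pow] at this
    have hneg : ∀ y : F, -y = y := fun y => by rw [← neg_one_mul, h2, one_mul]
    rw [hneg, hneg]
  · exact h.neg_pow x

variable {ψ : AddChar F R} {d : ℕ}

theorem dvd_binomialSum {π : R} (hπ : ∀ x : F, π ∣ ψ x - 1) (hq : π ∣ (Fintype.card F : R))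
    (a : F) : π ∣ binomialSum ψ d a := by
  have h : binomialSum ψ d a = ∑ x : F, (ψ (x ^ d - a * x) - 1) + Fintype.card F := by
    simp [binomialSum]
  rw [h]
  exact dvd_add (dvd_sum fun x _ => hπ _) hq

variable [IsDomain R]

theorem sum_map_neg_mul (hψ : ψ.IsPrimitive) [DecidableEq F] (b : F) :
    ∑ a : F, ψ (-(a * b)) = if b = 0 then (Fintype.card F : R) else 0 := by
  have h := AddChar.sum_mulShift b hψ
  push_cast at h
  rw [← h]
  exact Fintype.sum_equiv (Equiv.neg F) _ _ fun x => by simp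

theorem binomialSum_zero (hψ : ψ.IsPrimitive) (hd : Function.Bijective fun x : F => x ^ d) :
    binomialSum ψ d 0 = 0 := by
  classical
  have h := AddChar.sum_mulShift (1 : F) hψ
  simp only [mul_one, one_ne_zero, if_false] at h
  simp only [binomialSum, zero_mul, sub_zero]
  rw [hd.sum_comp (g := ψ), h]
  simp

theorem sum_binomialSum (hψ : ψ.IsPrimitive) (hd : 0 < d) :
    ∑ a : F, binomialSum ψ d a = Fintype.card F := by
  classical
  simp only [binomialSum]
  rw [sum_comm]
  simp_rw [sub_eq_add_neg, AddChar.map_add_eq_mul, ← mul_sum, sum_map_neg_mul hψ]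
  simp [hd.ne']

theorem sum_binomialSum_sq (hψ : ψ.IsPrimitive) (hneg : ∀ x : F, (-x) ^ d = -x ^ d) :
    ∑ a : F, binomialSum ψ d a ^ 2 = (Fintype.card F : R) ^ 2 := by
  classical
  have key : ∀ a : F, binomialSum ψ d a ^ 2
      = ∑ x : F, ∑ y : F, ψ (x ^ d + y ^ d) * ψ (-(a * (y + x))) := by
    intro a
    rw [binomialSum, sq, sum_mul_sum]
    refine sum_congr rfl fun x _ => sum_congr rfl fun y _ => ?_
    rw [← AddChar.map_add_eq_mul, ← AddChar.map_add_eq_mul]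
    congr 1; ring
  simp_rw [key]
  rw [sum_comm]
  have h2 : ∀ x : F, ∑ a : F, ∑ y : F, ψ (x ^ d + y ^ d) * ψ (-(a * (y + x)))
      = Fintype.card F := by
    intro x
    rw [sum_comm]
    simp_rw [← mul_sum, sum_map_neg_mul hψ, add_eq_zero_iff_eq_neg]
    simp [hneg]
  simp_rw [h2]
  simp [sq]

theorem sum_binomialSum_cube (hψ : ψ.IsPrimitive) (hd : Function.Bijective fun x : F => x ^ d) :
    (Fintype.card F : R) ^ 2 ∣ ∑ a : F, binomialSum ψ d a ^ 3 := by
  classical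
  set g : F → F → F := fun x y => x ^ d + y ^ d + (-(x + y)) ^ d with hg
  set T : R := ∑ x : F, ∑ y : F, ψ (g x y) with hT
  have key : ∀ a : F, binomialSum ψ d a ^ 3
      = ∑ x : F, ∑ y : F, ∑ z : F, ψ (x ^ d + y ^ d + z ^ d) * ψ (-(a * (z + (x + y)))) := by
    intro a
    rw [binomialSum, pow_succ, sq, sum_mul_sum, sum_mul]
    refine sum_congr rfl fun x _ => ?_
    rw [sum_mul_sum]
    refine sum_congr rfl fun y _ => sum_congr rfl fun z _ => ?_
    rw [← AddChar.map_add_eq_mul, ← AddChar.map_add_eq_mul, ← AddChar.map_add_eq_mul]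
    congr 1; ring
  have hsum : ∑ a : F, binomialSum ψ d a ^ 3 = Fintype.card F * T := by
    simp_rw [key]
    rw [sum_comm, hT, mul_sum]
    refine sum_congr rfl fun x _ => ?_
    rw [sum_comm, mul_sum]
    refine sum_congr rfl fun y _ => ?_
    rw [sum_comm]
    simp_rw [← mul_sum, sum_map_neg_mul hψ, add_eq_zero_iff_eq_neg]
    simp [hg, mul_comm]
  have hscale : ∀ t : F, t ≠ 0 → ∑ x : F, ∑ y : F, ψ (t * g x y) = T := by
    intro t ht
    obtain ⟨s, rfl⟩ := hd.surjective t
    have hs : s ≠ 0 := by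
      rintro rfl
      by_cases h0 : d = 0
      · subst h0
        exact zero_ne_one (hd.injective (by simp) : (0 : F) = 1)
      · exact ht (by simp [h0])
    rw [hT]
    refine Fintype.sum_equiv (Equiv.mulLeft₀ s hs) _ _ fun x =>
      Fintype.sum_equiv (Equiv.mulLeft₀ s hs) _ _ fun y => ?_
    simp only [hg]
    congr 1
    change s ^ d * (x ^ d + y ^ d + (-(x + y)) ^ d)
      = (s * x) ^ d + (s * y) ^ d + (-(s * x + s * y)) ^ d
    rw [show -(s * x + s * y) = s * -(x + y) by ring, mul_pow, mul_pow, mul_pow]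
    ring
  have hall : ∑ t : F, ∑ x : F, ∑ y : F, ψ (t * g x y)
      = (Fintype.card F : R) ^ 2 + (Fintype.card F - 1) * T := by
    rw [← add_sum_erase univ _ (mem_univ (0 : F))]
    rw [sum_congr rfl fun t ht => hscale t (ne_of_mem_erase ht)]
    simp [sq, card_erase_of_mem, Nat.cast_sub Fintype.card_pos]
  have hcount : (Fintype.card F : R) ∣ ∑ t : F, ∑ x : F, ∑ y : F, ψ (t * g x y) := by
    rw [sum_comm]
    refine dvd_sum fun x _ => ?_
    rw [sum_comm]
    refine dvd_sum fun y _ => ?_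
    rw [AddChar.sum_mulShift _ hψ]
    split_ifs <;> simp
  obtain ⟨c, hc⟩ := hcount
  rw [hsum, sq]
  refine mul_dvd_mul_left _ ⟨Fintype.card F + T - c, ?_⟩
  linear_combination hall - hc

end Moments

section RealEstimates

open Finset

theorem card_mul_le_sum_sq_of_pow_le_prod {ι : Type*} (S : Finset ι) (r : ι → ℝ) {c : ℝ}
    (hc : 0 ≤ c) (h : c ^ S.card ≤ |∏ i ∈ S, r i|) : S.card * c ^ 2 ≤ ∑ i ∈ S, r i ^ 2 := by
  rcases S.eq_empty_or_nonempty with rfl | hS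
  · simp
  have hpos : (0 : ℝ) < S.card := by exact_mod_cast hS.card_pos
  have hamgm := Real.geom_mean_le_arith_mean S (fun _ => 1) (fun i => r i ^ 2)
    (fun _ _ => zero_le_one) (by simpa using hS) (fun i _ => sq_nonneg (r i))
  simp only [Real.rpow_one, sum_const, nsmul_eq_mul, mul_one, one_mul] at hamgm
  have h1 : c ^ 2 ≤ (∏ i ∈ S, r i ^ 2) ^ (S.card : ℝ)⁻¹ := by
    rw [Real.le_rpow_inv_iff_of_pos (sq_nonneg c) (prod_nonneg fun i _ => sq_nonneg _) hpos,
      Real.rpow_natCast, prod_pow, ← sq_abs (∏ i ∈ S, r i), ← pow_mul, mul_comm, pow_mul]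
    gcongr
  have := h1.trans hamgm
  rw [le_div_iff₀ hpos] at this
  linarith

theorem lt_pred_mul_root {p q : ℕ} (hp : 2 ≤ p) (hpq : p ≤ q) (hq : 4 ≤ q) {ρ : ℝ}
    (hρ0 : 0 < ρ) (hρ : ρ ^ (p - 1) = p) : (q : ℝ) < (q - 1) * ρ := by
  by_contra! hle
  have hq0 : (0 : ℝ) < q := by exact_mod_cast (by omega : 0 < q)
  have hp0 : (2 : ℝ) ≤ p := by exact_mod_cast hp
  have hq1 : (4 : ℝ) ≤ q := by exact_mod_cast hq
  have hpow : (1 + -(1 / (q : ℝ))) ^ (p - 1) * p ≤ 1 := by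
    rw [← hρ, ← mul_pow]
    apply pow_le_one₀
    · have : (1 : ℝ) / q ≤ 1 := by rw [div_le_one hq0]; linarith
      exact mul_nonneg (by linarith) hρ0.le
    · have : (1 + -(1 / (q : ℝ))) * ρ = (q - 1) * ρ / q := by field_simp; ring
      rw [this, div_le_one hq0]; exact hle
  have hcast : ((p - 1 : ℕ) : ℝ) = p - 1 := by rw [Nat.cast_sub (by omega)]; simp
  rcases hpq.eq_or_lt with rfl | hlt
  · have hb := one_add_mul_self_lt_rpow_one_add (s := -(1 / (p : ℝ))) (p := ((p - 1 : ℕ) : ℝ))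
      (by rw [neg_le_neg_iff, div_le_one hq0]; linarith)
      (by simp; omega) (by rw [hcast]; linarith)
    rw [Real.rpow_natCast, hcast] at hb
    have h1 : 1 + ((p : ℝ) - 1) * -(1 / (p : ℝ)) = 1 / p := by field_simp; ring
    rw [h1, div_lt_iff₀ hq0] at hb
    linarith
  · have hb := one_add_mul_le_pow (a := -(1 / (q : ℝ)))
      (by rw [neg_le_neg_iff, div_le_iff₀ hq0]; linarith) (p - 1)
    rw [hcast] at hb
    have hlt' : (p : ℝ) + 1 ≤ q := by exact_mod_cast hlt
    have h1 : (1 + ((p : ℝ) - 1) * -(1 / (q : ℝ))) * p ≤ 1 :=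
      (mul_le_mul_of_nonneg_right hb (by linarith)).trans hpow
    have h2 : (1 + ((p : ℝ) - 1) * -(1 / (q : ℝ))) * p = (q - (p - 1)) * p / q := by
      field_simp; ring
    rw [h2, div_le_one hq0] at h1
    nlinarith

theorem small_value_lt_one_add {α μ y N N' Q q : ℝ} (hμ : 1 < μ) (hq : 0 < q)
    (hy : y * μ = q) (hα : 0 < α) (hαy : α < y) (hcard : N + N' = q - 1)
    (hlin : N * α ≤ q + Q / y) (hsq : N * α ^ 2 + Q = q ^ 2) (hN' : N' * y ^ 2 ≤ Q) :
    α < 1 + μ := by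
  have hy0 : 0 < y := hα.trans hαy
  by_contra! hle
  have h1 : N * α * (y + α) ≤ q * (y + q) := by
    have := mul_le_mul_of_nonneg_right hlin hy0.le
    rw [add_mul, div_mul_cancel₀ _ hy0.ne'] at this
    nlinarith
  have h2 : (q - 1) * y ^ 2 - q ^ 2 ≤ N * (y ^ 2 - α ^ 2) := by
    have : N' = q - 1 - N := by linarith
    subst this
    nlinarith
  have h3 : α * ((q - 1) * y ^ 2 - q ^ 2) ≤ q * (y + q) * (y - α) := by
    calc _ ≤ α * (N * (y ^ 2 - α ^ 2)) := mul_le_mul_of_nonneg_left h2 hα.le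
      _ = N * α * (y + α) * (y - α) := by ring
      _ ≤ _ := mul_le_mul_of_nonneg_right h1 (by linarith)
  have h4 : α * ((q - 1) * y + q) ≤ q * (y + q) := by
    have : y * (α * ((q - 1) * y + q)) ≤ y * (q * (y + q)) := by nlinarith
    exact le_of_mul_le_mul_left this hy0
  have h6 : 0 ≤ (q - 1) * y + q := by
    subst hy
    nlinarith [mul_pos hy0 hy0]
  have h5 : (1 + μ) * ((q - 1) * y + q) ≤ q * (y + q) :=
    (mul_le_mul_of_nonneg_right hle h6).trans h4
  subst hy
  nlinarith [mul_pos hy0 hy0]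

end RealEstimates

section Invariant

open Finset

variable {R Γ : Type*} [CommRing R] [IsDomain R] [Group Γ]
  [MulSemiringAction Γ R] {π : R} {p : ℕ}

theorem exists_pow_dvd_intCast_iff [Fact p.Prime] (hπ : Prime π)
    (hassoc : Associated (π ^ (p - 1)) (p : R)) (hint : ∀ n : ℤ, π ∣ (n : R) ↔ (p : ℤ) ∣ n)
    {n : ℤ} (hn : n ≠ 0) :
    ∃ j : ℕ, (p : ℤ) ^ j ∣ n ∧ ∀ k : ℕ, π ^ k ∣ (n : R) ↔ k ≤ (p - 1) * j := by
  have hfin : FiniteMultiplicity (p : ℤ) n :=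
    Int.finiteMultiplicity_iff.mpr ⟨by simpa using (Fact.out : p.Prime).ne_one, hn⟩
  obtain ⟨m, hm, hpm⟩ := hfin.exists_eq_pow_mul_and_not_dvd
  set j := multiplicity (p : ℤ) n
  refine ⟨j, ⟨m, hm⟩, fun k => ?_⟩
  have hnR : Associated (n : R) (π ^ ((p - 1) * j) * m) := by
    rw [hm, pow_mul]
    push_cast
    exact ((hassoc.pow_pow (n := j)).mul_right _).symm
  rw [hnR.dvd_iff_dvd_right]
  constructor
  · intro h
    have := hπ.pow_dvd_of_dvd_mul_right k (by rwa [hint]) h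
    exact (pow_dvd_pow_iff hπ.ne_zero hπ.not_isUnit).mp this
  · exact fun h => (pow_dvd_pow π h).mul_right _

theorem pow_le_abs_of_pow_dvd [Fact p.Prime] (hπ : Prime π)
    (hassoc : Associated (π ^ (p - 1)) (p : R)) (hint : ∀ n : ℤ, π ∣ (n : R) ↔ (p : ℤ) ∣ n)
    {ρ : ℝ} (hρ1 : 1 ≤ ρ) (hρ : ρ ^ (p - 1) = p) {n : ℤ} (hn : n ≠ 0) {k : ℕ}
    (hk : π ^ k ∣ (n : R)) : ρ ^ k ≤ |(n : ℝ)| := by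
  obtain ⟨j, hj, hiff⟩ := exists_pow_dvd_intCast_iff hπ hassoc hint hn
  calc ρ ^ k ≤ ρ ^ ((p - 1) * j) := pow_le_pow_right₀ hρ1 ((hiff k).mp hk)
    _ = (((p : ℤ) ^ j : ℤ) : ℝ) := by rw [pow_mul, hρ]; push_cast; rfl
    _ ≤ |(n : ℝ)| := by
      have := Int.le_of_dvd (abs_pos.mpr hn) ((dvd_abs _ _).mpr hj)
      exact_mod_cast this

omit [IsDomain R] in
theorem pow_dvd_smul_iff (hsmul : ∀ σ : Γ, Associated π (σ • π)) (σ : Γ) (k : ℕ) (x : R) :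
    π ^ k ∣ σ • x ↔ π ^ k ∣ x := by
  rw [((hsmul σ).pow_pow (n := k)).dvd_iff_dvd_left, ← smul_pow']
  exact map_dvd_iff (MulSemiringAction.toRingEquiv Γ R σ)

omit [IsDomain R] in
theorem smul_eq_self_of_multiplicity_ne (hsmul : ∀ σ : Γ, Associated π (σ • π)) {x : R} {V : Set R}
    (hV : ∀ σ : Γ, σ • x ∈ V)
    (hne : ∀ y ∈ V, y ≠ x → multiplicity π y ≠ multiplicity π x) (σ : Γ) : σ • x = x := by
  by_contra hcon
  refine hne _ (hV σ) hcon (multiplicity_eq_of_emultiplicity_eq ?_)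
  exact emultiplicity_eq_emultiplicity_iff.mpr fun k => pow_dvd_smul_iff hsmul σ k x

variable [Algebra.IsInvariant ℤ R Γ]

/-- Arithmetic-geometric mean inequality over a Galois-stable set of values: their product is a
rational integer whose size is bounded below by its divisibility. -/
theorem card_mul_pow_le_sum_sq [Fact p.Prime] (hπ : Prime π)
    (hassoc : Associated (π ^ (p - 1)) (p : R)) (hint : ∀ n : ℤ, π ∣ (n : R) ↔ (p : ℤ) ∣ n)
    {ρ : ℝ} (hρ1 : 1 ≤ ρ) (hρ : ρ ^ (p - 1) = p) {G : Type*} [Fintype G] {w : G → R}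
    {r : G → ℝ} {φ : R →+* ℂ} (hr : ∀ a, φ (w a) = r a)
    (hw : ∀ σ : Γ, ∃ e : Equiv.Perm G, ∀ a, σ • w a = w (e a)) (h0 : ∀ a, w a ≠ 0)
    (P : R → Prop) [DecidablePred P] (hP : ∀ (σ : Γ) x, P x → P (σ • x)) {k : ℕ}
    (hk : ∀ a, P (w a) → π ^ k ∣ w a) :
    (#{a | P (w a)} : ℝ) * (ρ ^ k) ^ 2 ≤ ∑ a with P (w a), r a ^ 2 := by
  apply card_mul_le_sum_sq_of_pow_le_prod _ _ (by positivity)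
  have hfix : ∀ σ : Γ, σ • (∏ a with P (w a), w a) = ∏ a with P (w a), w a := by
    intro σ
    obtain ⟨e, he⟩ := hw σ
    rw [smul_prod']
    refine prod_equiv e (fun a => ?_) fun a _ => he a
    simp only [mem_filter, mem_univ, true_and, ← he]
    exact ⟨hP σ _, fun h => by simpa using hP σ⁻¹ _ h⟩
  obtain ⟨n, hn⟩ := Algebra.IsInvariant.isInvariant (A := ℤ) _ hfix
  rw [algebraMap_int_eq, eq_intCast] at hn
  have hn0 : n ≠ 0 := by
    rintro rfl
    rw [Int.cast_zero] at hn
    exact prod_ne_zero_iff.mpr (fun a _ => h0 a) hn.symm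
  have hnr : (n : ℝ) = ∏ a with P (w a), r a := by
    have := congrArg φ hn
    rw [map_intCast, map_prod] at this
    simp_rw [hr] at this
    exact_mod_cast this
  rw [← hnr, ← pow_mul]
  refine pow_le_abs_of_pow_dvd hπ hassoc hint hρ1 hρ hn0 ?_
  rw [hn, pow_mul, ← prod_const]
  exact prod_dvd_prod_of_dvd _ _ fun a ha => hk a (mem_filter.mp ha).2


variable [CharZero R] [WfDvdMonoid R]

set_option maxHeartbeats 1000000 in
/-- A family of algebraic integers with the symmetries and the power moments of a Weil spectrum
cannot take exactly three values, all of them nonzero. -/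
theorem false_of_three_nonzero_values [Fact p.Prime] (hπ : Prime π)
    (hassoc : Associated (π ^ (p - 1)) (p : R)) (hint : ∀ n : ℤ, π ∣ (n : R) ↔ (p : ℤ) ∣ n)
    (hsmul : ∀ σ : Γ, Associated π (σ • π))
    {G : Type*} [Fintype G] {w : G → R} {r : G → ℝ} {φ : R →+* ℂ} (hφ : Function.Injective φ)
    (hr : ∀ a, φ (w a) = r a) (hw : ∀ σ : Γ, ∃ e : Equiv.Perm G, ∀ a, σ • w a = w (e a))
    {n : ℕ} (hcard : Fintype.card G + 1 = p ^ n) (h1 : ∑ a, w a = (p : R) ^ n)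
    (h2 : ∑ a, w a ^ 2 = ((p : R) ^ n) ^ 2) (h3 : ((p : R) ^ n) ^ 2 ∣ ∑ a, w a ^ 3)
    (hπw : ∀ a, π ∣ w a) {A B C : R} (hAB : A ≠ B) (hAC : A ≠ C) (hBC : B ≠ C)
    (hrange : Set.range w = {A, B, C}) (hA0 : A ≠ 0) (hB0 : B ≠ 0) (hC0 : C ≠ 0)
    (hvAB : multiplicity π A ≤ multiplicity π B) (hvBC : multiplicity π B ≤ multiplicity π C) :
    False := by
  classical
  have hp2 : 2 ≤ p := (Fact.out : p.Prime).two_le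
  have hmem : ∀ a, w a = A ∨ w a = B ∨ w a = C := fun a => by
    have : w a ∈ Set.range w := ⟨a, rfl⟩
    rwa [hrange] at this
  obtain ⟨a, ha⟩ : A ∈ Set.range w := by rw [hrange]; simp
  obtain ⟨b, hb⟩ : B ∈ Set.range w := by rw [hrange]; simp
  obtain ⟨c, hc⟩ : C ∈ Set.range w := by rw [hrange]; simp
  have h0 : ∀ x, w x ≠ 0 := fun x => by
    rcases hmem x with h | h | h <;> rw [h] <;> assumption
  have hdvd : ∀ {x : R} {k : ℕ}, x ≠ 0 → (π ^ k ∣ x ↔ k ≤ multiplicity π x) := fun {x k} hx =>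
    (FiniteMultiplicity.of_prime_left hπ hx).pow_dvd_iff_le_multiplicity
  set kA := multiplicity π A with hkA
  set kB := multiplicity π B with hkB
  set kC := multiplicity π C with hkC
  set E := (p - 1) * n with hE
  -- cardinalities
  have hG : 3 ≤ Fintype.card G := by
    have h3c : ({a, b, c} : Finset G).card = 3 := by
      rw [card_eq_three]
      refine ⟨a, b, c, ?_, ?_, ?_, rfl⟩ <;> rintro rfl <;> simp_all
    rw [← h3c]
    exact card_le_univ _
  have hn : n ≠ 0 := by
    rintro rfl
    rw [pow_zero] at hcard
    omega
  have hpq : p ≤ p ^ n := Nat.le_self_pow hn p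
  have hq4 : 4 ≤ p ^ n := by omega
  set q : ℝ := (p : ℝ) ^ n with hq
  have hqpos : 0 < q := by positivity
  have hcardR : (Fintype.card G : ℝ) = q - 1 := by
    rw [eq_sub_iff_add_eq, hq]; exact_mod_cast hcard
  have hcardR' : (Fintype.card G : R) = (p : R) ^ n - 1 := by
    rw [eq_sub_iff_add_eq]; exact_mod_cast hcard
  -- the size of the uniformizer
  obtain ⟨ρ, hρ0, hρ⟩ : ∃ ρ : ℝ, 0 < ρ ∧ ρ ^ (p - 1) = p :=
    ⟨(p : ℝ) ^ ((p - 1 : ℕ) : ℝ)⁻¹, by positivity,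
      Real.rpow_inv_natCast_pow (by positivity) (by omega)⟩
  have hρ1 : 1 < ρ := by
    by_contra! hle
    have := pow_le_one₀ hρ0.le hle (n := p - 1)
    rw [hρ] at this
    have : (2 : ℝ) ≤ p := by exact_mod_cast hp2
    linarith
  have hρE : ρ ^ E = q := by rw [hE, pow_mul, hρ]
  have hπE : π ^ E ∣ (p : R) ^ n := by
    rw [hE, pow_mul]; exact pow_dvd_pow_of_dvd hassoc.dvd n
  have hE0 : 0 < E := Nat.mul_pos (by omega) (by omega)
  have hbound := fun (P : R → Prop) (hP : ∀ (σ : Γ) x, P x → P (σ • x)) (k : ℕ)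
    (hk : ∀ a, P (w a) → π ^ k ∣ w a) =>
    card_mul_pow_le_sum_sq hπ hassoc hint hρ1.le hρ hr hw h0 P hP hk
  -- real moments
  have hr1 : ∑ x, r x = q := by
    have := congrArg φ h1
    simp only [map_sum, hr, map_pow, map_natCast] at this
    rw [hq]
    exact_mod_cast this
  have hr2 : ∑ x, r x ^ 2 = q ^ 2 := by
    have := congrArg φ h2
    simp only [map_sum, map_pow, hr, map_natCast] at this
    rw [hq]
    exact_mod_cast this
  have hr0 : ∀ x, r x ≠ 0 := fun x hx => h0 x (hφ (by rw [hr, hx]; simp))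
  -- a uniform divisibility of all values is at most `q ^ (1 / 2)`
  have huniform : ∀ k, E + 1 ≤ 2 * k → q ^ 2 < (q - 1) * (ρ ^ k) ^ 2 := by
    intro k hk
    have hlt := lt_pred_mul_root hp2 hpq hq4 hρ0 hρ
    push_cast at hlt
    rw [← hq] at hlt
    calc q ^ 2 = q * q := sq q
      _ < q * ((q - 1) * ρ) := by gcongr
      _ = (q - 1) * ρ ^ (E + 1) := by rw [pow_succ, hρE]; ring
      _ ≤ (q - 1) * (ρ ^ k) ^ 2 := by
        rw [← pow_mul, mul_comm k 2]
        refine mul_le_mul_of_nonneg_left (pow_le_pow_right₀ hρ1.le hk) ?_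
        rw [← hcardR]; positivity
  -- no value is divisible by `q`
  have hkCE : kC < E := by
    by_contra! hle
    have hb' := hbound (fun x => π ^ E ∣ x)
      (fun σ x hx => (pow_dvd_smul_iff hsmul σ E x).mpr hx) E (fun _ h => h)
    rw [hρE] at hb'
    have hsplit := sum_filter_add_sum_filter_not univ (fun x => π ^ E ∣ w x) (fun x => r x ^ 2)
    rw [hr2] at hsplit
    have hcardpos : 1 ≤ #{x | π ^ E ∣ w x} := card_pos.mpr ⟨c, by
      rw [mem_filter, hc]; exact ⟨mem_univ _, (hdvd hC0).mpr hle⟩⟩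
    have hcardR1 : (1 : ℝ) ≤ (#{x | π ^ E ∣ w x} : ℝ) := by exact_mod_cast hcardpos
    have hnot : ∑ x with ¬ π ^ E ∣ w x, r x ^ 2 ≤ 0 := by nlinarith [sq_nonneg q]
    have hempty : ∀ x, π ^ E ∣ w x := by
      by_contra! ⟨x, hx⟩
      have : 0 < ∑ x with ¬ π ^ E ∣ w x, r x ^ 2 :=
        sum_pos (fun y _ => by have := hr0 y; positivity) ⟨x, by simpa using hx⟩
      linarith
    rw [filter_true_of_mem fun x _ => hempty x, hr2, card_univ] at hb'
    have : (3 : ℝ) ≤ Fintype.card G := by exact_mod_cast hG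
    nlinarith [sq_pos_of_pos hqpos]
  -- the product of the values is divisible by `q ^ 2`
  have hsum : 2 * E ≤ kA + kB + kC := by
    by_contra! hlt
    have hzero : ∑ x, (w x - A) * (w x - B) * (w x - C) = 0 := sum_eq_zero fun x _ => by
      rcases hmem x with h | h | h <;> simp [h]
    have hexp : ∑ x, (w x - A) * (w x - B) * (w x - C) = ∑ x, w x ^ 3
        - (A + B + C) * ∑ x, w x ^ 2 + (A * B + A * C + B * C) * ∑ x, w x
        - Fintype.card G * (A * B * C) := by
      rw [mul_sum, mul_sum, ← nsmul_eq_mul, ← card_univ, ← sum_const, ← sum_sub_distrib,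
        ← sum_add_distrib, ← sum_sub_distrib]
      exact sum_congr rfl fun x _ => by ring
    obtain ⟨m, hm⟩ := h3
    rw [hzero, h1, h2, hm, hcardR'] at hexp
    have hprod : A * B * C = (p : R) ^ n * (A * B * C)
        - (p : R) ^ n * (A * B) - (p : R) ^ n * (A * C) - (p : R) ^ n * (B * C)
        + ((p : R) ^ n) ^ 2 * (A + B + C - m) := by linear_combination -hexp
    have hdA : π ^ kA ∣ A := pow_multiplicity_dvd _ _
    have hdB : π ^ kB ∣ B := pow_multiplicity_dvd _ _
    have hdC : π ^ kC ∣ C := pow_multiplicity_dvd _ _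
    have hle : ∀ {j : ℕ} {x : R}, π ^ j ∣ x → kA + kB + kC + 1 ≤ j → π ^ (kA + kB + kC + 1) ∣ x :=
      fun hx hj => (pow_dvd_pow π hj).trans hx
    have hABC : A * B * C ≠ 0 := mul_ne_zero (mul_ne_zero hA0 hB0) hC0
    have hfin := FiniteMultiplicity.of_prime_left hπ hABC
    have hmul : multiplicity π (A * B * C) = kA + kB + kC := by
      rw [multiplicity_mul hπ hfin, multiplicity_mul hπ hfin.mul_left]
    have : π ^ (kA + kB + kC + 1) ∣ A * B * C := by
      rw [hprod]
      refine dvd_add (dvd_sub (dvd_sub (dvd_sub ?_ ?_) ?_) ?_) (Dvd.dvd.mul_right ?_ _)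
      · refine hle (j := E + (kA + kB + kC)) ?_ (by omega)
        simp only [pow_add]
        exact mul_dvd_mul hπE (mul_dvd_mul (mul_dvd_mul hdA hdB) hdC)
      · refine hle (j := E + (kA + kB)) ?_ (by omega)
        simp only [pow_add]
        exact mul_dvd_mul hπE (mul_dvd_mul hdA hdB)
      · refine hle (j := E + (kA + kC)) ?_ (by omega)
        simp only [pow_add]
        exact mul_dvd_mul hπE (mul_dvd_mul hdA hdC)
      · refine hle (j := E + (kB + kC)) ?_ (by omega)
        simp only [pow_add]
        exact mul_dvd_mul hπE (mul_dvd_mul hdB hdC)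
      · refine hle (j := E * 2) ?_ (by omega)
        rw [pow_mul]
        exact pow_dvd_pow_of_dvd hπE 2
    rw [hdvd hABC, hmul] at this
    omega
  -- the smallest divisibility is attained once only
  have hkAB : kA < kB := by
    by_contra! hle
    have hall : ∀ x, π ^ kA ∣ w x := fun x => by
      rcases hmem x with h | h | h
      · rw [h, hdvd hA0]
      · rw [h, hdvd hB0]; exact hvAB
      · rw [h, hdvd hC0]; exact hvAB.trans hvBC
    have hb' := hbound (fun _ => True) (fun _ _ _ => trivial) kA (fun x _ => hall x)
    rw [filter_true, hr2, card_univ, hcardR] at hb'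
    exact absurd (huniform kA (by omega)) (not_lt.mpr hb')
  have hstable : ∀ (σ : Γ) {x : R}, x ∈ Set.range w → σ • x ∈ Set.range w := by
    rintro σ _ ⟨x, rfl⟩
    obtain ⟨e, he⟩ := hw σ
    exact ⟨e x, (he x).symm⟩
  have hfixA : ∀ σ : Γ, σ • A = A :=
    smul_eq_self_of_multiplicity_ne hsmul (fun σ => hstable σ ⟨a, ha⟩) (by
      rw [hrange]
      rintro y (rfl | rfl | rfl) hy
      · exact absurd rfl hy
      · omega
      · omega)
  obtain ⟨m, hm⟩ := Algebra.IsInvariant.isInvariant (A := ℤ) A hfixA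
  rw [algebraMap_int_eq, eq_intCast] at hm
  have hm0 : m ≠ 0 := by rintro rfl; simp at hm; exact hA0 hm.symm
  have hra : ∀ x, w x = A → r x = m := fun x hx => by
    have := hr x
    rw [hx, ← hm, map_intCast] at this
    exact_mod_cast this.symm
  have hαkA : ρ ^ kA ≤ |(m : ℝ)| := pow_le_abs_of_pow_dvd hπ hassoc hint hρ1.le hρ hm0
    (by rw [hm]; exact pow_multiplicity_dvd _ _)
  have hαp : (p : ℝ) ≤ |(m : ℝ)| := by
    have hdvdm : (p : ℤ) ∣ m := by rw [← hint, hm, ← ha]; exact hπw a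
    have := Int.le_of_dvd (abs_pos.mpr hm0) ((dvd_abs _ _).mpr hdvdm)
    exact_mod_cast this
  set α : ℝ := |(m : ℝ)| with hα
  have hα0 : 0 < α := abs_pos.mpr (by exact_mod_cast hm0)
  set μ := ρ ^ (E - kB) with hμ
  set ν := ρ ^ (E - kC) with hν
  set y := ρ ^ kB with hy
  have hy0 : 0 < y := pow_pos hρ0 _
  have hyμ : y * μ = q := by rw [hy, hμ, ← pow_add, ← hρE]; congr 1; omega
  have hμ1 : 1 < μ := one_lt_pow₀ hρ1 (by omega)
  have hμν : μ * ν ≤ α := by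
    refine le_trans ?_ hαkA
    rw [hμ, hν, ← pow_add]
    exact pow_le_pow_right₀ hρ1.le (by omega)
  -- splitting off the smallest value
  set N : ℝ := (#{x | w x = A} : ℝ) with hN
  set N' : ℝ := (#{x | ¬ w x = A} : ℝ) with hN'
  set Q : ℝ := ∑ x with ¬ w x = A, r x ^ 2 with hQ
  have hNN : N + N' = q - 1 := by
    rw [← hcardR, hN, hN', ← card_univ]
    exact_mod_cast card_filter_add_card_filter_not (s := univ) (fun x => w x = A)
  have hsqN : ∑ x with w x = A, r x ^ 2 = N * α ^ 2 := by
    rw [sum_congr rfl fun x hx => by rw [hra x (mem_filter.mp hx).2], sum_const, nsmul_eq_mul,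
      hα, sq_abs]
  have hNQ : N * α ^ 2 + Q = q ^ 2 := by
    rw [← hr2, ← hsqN]
    exact sum_filter_add_sum_filter_not univ (fun x => w x = A) (fun x => r x ^ 2)
  have hN'Q : N' * y ^ 2 ≤ Q := by
    have hb' := hbound (fun x => ¬ x = A) (fun σ x hx h => hx ?_) kB (fun x hx => ?_)
    · convert hb'
    · rw [← hfixA σ] at h
      exact smul_left_cancel σ h
    · rcases hmem x with h | h | h
      · exact absurd h hx
      · rw [h, hdvd hB0]
      · rw [h, hdvd hC0]; exact hvBC
  have hQ0 : 0 ≤ Q := sum_nonneg fun x _ => sq_nonneg _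
  have hlin : N * α ≤ q + Q / y := by
    have hsplit := sum_filter_add_sum_filter_not univ (fun x => w x = A) r
    rw [hr1, sum_congr rfl fun x hx => hra x (mem_filter.mp hx).2, sum_const, nsmul_eq_mul]
      at hsplit
    have hcs : (∑ x with ¬ w x = A, r x) ^ 2 ≤ N' * Q := sq_sum_le_card_mul_sum_sq
    have habs : |∑ x with ¬ w x = A, r x| ≤ Q / y := by
      apply abs_le_of_sq_le_sq _ (by positivity)
      rw [div_pow, le_div_iff₀ (by positivity)]
      nlinarith [mul_le_mul_of_nonneg_right hcs (sq_nonneg y)]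
    calc N * α = |N * m| := by rw [abs_mul, abs_of_nonneg (by positivity : 0 ≤ N)]
      _ = |q - ∑ x with ¬ w x = A, r x| := by rw [← hsplit, add_sub_cancel_right]
      _ ≤ |q| + |∑ x with ¬ w x = A, r x| := abs_sub _ _
      _ ≤ q + Q / y := by rw [abs_of_pos hqpos]; gcongr
  have hαy : α < y := by
    by_contra! hle
    have h := huniform kB (by omega)
    rw [← hNN, ← hy, ← hNQ] at h
    have : N * y ^ 2 ≤ N * α ^ 2 := by gcongr
    linarith
  have hfinal : α < 1 + μ := small_value_lt_one_add hμ1 hqpos hyμ hα0 hαy hNN hlin hNQ hN'Q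
  have hp2R : (2 : ℝ) ≤ p := by exact_mod_cast hp2
  have hdiv : (p - 1) ∣ kC → False := by
    rintro ⟨j, hj⟩
    have hjn : j < n := by
      rw [hj, hE] at hkCE
      exact lt_of_mul_lt_mul_left hkCE (Nat.zero_le _)
    have hle : p - 1 ≤ E - kC := by
      rw [hj, hE, ← Nat.mul_sub]
      exact Nat.le_mul_of_pos_right _ (by omega)
    have hν2 : 2 ≤ ν := hp2R.trans (hρ ▸ pow_le_pow_right₀ hρ1.le hle)
    have : μ * 2 ≤ μ * ν := by gcongr
    linarith
  rcases hvBC.eq_or_lt with heq | hlt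
  · have hνμ : ν = μ := by rw [hν, hμ, heq]
    rw [hνμ] at hμν
    have hp3 : 3 ≤ p := by
      by_contra! hlt
      exact hdiv (by rw [show p - 1 = 1 by omega]; exact one_dvd _)
    have : (3 : ℝ) ≤ p := by exact_mod_cast hp3
    have hμ2 : 2 < μ := by linarith
    have : 2 * μ < μ * μ := by gcongr
    linarith
  · have hfixC : ∀ σ : Γ, σ • C = C :=
      smul_eq_self_of_multiplicity_ne hsmul (fun σ => hstable σ ⟨c, hc⟩) (by
        rw [hrange]
        rintro y (rfl | rfl | rfl) hy
        · omega
        · omega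
        · exact absurd rfl hy)
    obtain ⟨l, hl⟩ := Algebra.IsInvariant.isInvariant (A := ℤ) C hfixC
    rw [algebraMap_int_eq, eq_intCast] at hl
    have hl0 : l ≠ 0 := by rintro rfl; simp at hl; exact hC0 hl.symm
    obtain ⟨j, -, hj⟩ := exists_pow_dvd_intCast_iff hπ hassoc hint hl0
    refine hdiv ⟨j, le_antisymm ?_ ?_⟩
    · rw [← hj, hl]; exact pow_multiplicity_dvd _ _
    · rw [hkC, ← hdvd hC0, ← hl, hj]

end Invariant

section TraceChar

variable (F : Type*) [Field F] (p : ℕ) [Fact p.Prime] [CharP F p] {R : Type*} [CommRing R]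

/-- The additive character `x ↦ ζ ^ Tr x` of a field of characteristic `p`, where `ζ ^ p = 1`. -/
noncomputable def traceChar {ζ : R} (hζ : ζ ^ p = 1) : AddChar F R :=
  letI : Algebra (ZMod p) F := ZMod.algebra F p
  (AddChar.zmodChar p hζ).compAddMonoidHom (Algebra.trace (ZMod p) F).toAddMonoidHom

variable {F p} {ζ : R}

theorem traceChar_apply (hζ : ζ ^ p = 1) (x : F) :
    letI : Algebra (ZMod p) F := ZMod.algebra F p
    traceChar F p hζ x = ζ ^ (Algebra.trace (ZMod p) F x).val := rfl

theorem traceChar_isPrimitive [Finite F] (hζ : IsPrimitiveRoot ζ p) :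
    (traceChar F p hζ.pow_eq_one).IsPrimitive := by
  let : Algebra (ZMod p) F := ZMod.algebra F p
  obtain ⟨x, hx⟩ := Algebra.trace_surjective (ZMod p) F 1
  refine AddChar.IsPrimitive.of_ne_one fun h => ?_
  have h1 := DFunLike.congr_fun h x
  have := (Fact.out : p.Prime).one_lt
  have : Fact (1 < p) := ⟨this⟩
  rw [traceChar_apply, hx, ZMod.val_one, pow_one, AddChar.one_apply] at h1
  exact hζ.ne_one this.out h1

theorem sub_one_dvd_traceChar_sub_one (hζ : ζ ^ p = 1) (x : F) :
    ζ - 1 ∣ traceChar F p hζ x - 1 := by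
  rw [traceChar_apply]
  exact sub_one_dvd_pow_sub_one _ _

theorem traceChar_pow_eq_one (hζ : ζ ^ p = 1) (x : F) : traceChar F p hζ x ^ p = 1 := by
  rw [traceChar_apply, ← pow_mul, mul_comm, pow_mul, hζ, one_pow]

theorem map_traceChar [Fintype F] (hζ : ζ ^ p = 1) {φ : R →+* ℂ}
    (hφ : φ ζ = Complex.exp (2 * Real.pi * Complex.I / p)) (x : F) :
    φ (traceChar F p hζ x) = canonicalPsi F p x := by
  rw [traceChar_apply, map_pow, hφ, ← Complex.exp_nat_mul, canonicalPsi]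
  congr 1
  ring

end TraceChar

section Symmetries

open Finset

variable {F R : Type*} [Field F] [Fintype F] [CommRing R] {ψ : AddChar F R} {d : ℕ}

theorem map_binomialSum_of_map_eq_pow (hd : Function.Bijective fun x : F => x ^ d) {σ : R →+* R}
    {k : ℕ} (hk : (k : F) ≠ 0) (hσ : ∀ x, σ (ψ x) = ψ x ^ k) :
    ∃ c : Fˣ, ∀ a, σ (binomialSum ψ d a) = binomialSum ψ d (c * a) := by
  obtain ⟨u, hu⟩ := hd.surjective k
  replace hu : u ^ d = k := hu
  have hd0 : d ≠ 0 := by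
    rintro rfl
    exact zero_ne_one (hd.injective (by simp : (0 : F) ^ 0 = 1 ^ 0))
  have hu0 : u ≠ 0 := by
    rintro rfl
    rw [zero_pow hd0] at hu
    exact hk hu.symm
  refine ⟨Units.mk0 _ hk * (Units.mk0 u hu0)⁻¹, fun a => ?_⟩
  simp only [binomialSum, map_sum, hσ, ← AddChar.map_nsmul_eq_pow]
  refine Fintype.sum_equiv (Equiv.mulLeft₀ u hu0) _ _ fun x => ?_
  congr 1
  change k • (x ^ d - a * x) = (u * x) ^ d - _ * (u * x)
  rw [mul_pow, hu, nsmul_eq_mul, Units.val_mul, Units.val_mk0, Units.val_inv_eq_inv_val,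
    Units.val_mk0]
  field_simp

theorem exists_ofReal_eq_binomialSum {ψ : AddChar F ℂ} (hneg : ∀ x : F, (-x) ^ d = -x ^ d)
    (a : F) : ∃ r : ℝ, binomialSum ψ d a = r := by
  refine ⟨(binomialSum ψ d a).re, (Complex.conj_eq_iff_re.mp ?_).symm⟩
  rw [binomialSum, map_sum]
  refine Fintype.sum_equiv (Equiv.neg F) _ _ fun x => ?_
  rw [← AddChar.map_neg_eq_conj, Equiv.neg_apply, hneg]
  congr 1
  ring

end Symmetries

section Cyclotomic

open Finset NumberField

theorem IsPrimitiveRoot.exists_algHom_apply_eq {n : ℕ} [NeZero n] {K : Type*} [Field K]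
    [NumberField K] [IsCyclotomicExtension {n} ℚ K] {ζ : K} (hζ : IsPrimitiveRoot ζ n) {η : ℂ}
    (hη : IsPrimitiveRoot η n) : ∃ φ : K →ₐ[ℚ] ℂ, φ ζ = η := by
  have hirr := Polynomial.cyclotomic.irreducible_rat (NeZero.pos n)
  refine ⟨(hζ.embeddingsEquivPrimitiveRoots ℂ hirr).symm
    ⟨η, (mem_primitiveRoots (NeZero.pos n)).mpr hη⟩, ?_⟩
  rw [← hζ.embeddingsEquivPrimitiveRoots_apply_coe ℂ hirr, Equiv.apply_symm_apply]

theorem not_three_nonzero_values {F : Type*} [Field F] [Fintype F] {p : ℕ} [Fact p.Prime]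
    [CharP F p] {K : Type*} [Field K] [NumberField K] [IsCyclotomicExtension {p} ℚ K] {ζ : K}
    (hζ : IsPrimitiveRoot ζ p) {d : ℕ} (hd : 0 < d)
    (hgcd : Nat.gcd d (Fintype.card F - 1) = 1) {φ : 𝓞 K →+* ℂ} (hφ : Function.Injective φ)
    {A B C : 𝓞 K} (hAB : A ≠ B)
    (hAC : A ≠ C) (hBC : B ≠ C)
    (hrange : Set.range (fun a : Fˣ =>
      binomialSum (traceChar F p hζ.toInteger_isPrimitiveRoot.pow_eq_one) d a) = {A, B, C})
    (hA0 : A ≠ 0) (hB0 : B ≠ 0) (hC0 : C ≠ 0)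
    (hvAB : multiplicity (hζ.toInteger - 1) A ≤ multiplicity (hζ.toInteger - 1) B)
    (hvBC : multiplicity (hζ.toInteger - 1) B ≤ multiplicity (hζ.toInteger - 1) C) : False := by
  have : IsGalois ℚ K := IsCyclotomicExtension.isGalois {p} ℚ K
  classical
  have hbij := pow_bijective_of_gcd hd hgcd
  have hneg := neg_pow_of_gcd hgcd
  have hζ' := hζ.toInteger_isPrimitiveRoot
  have hψ := traceChar_isPrimitive (F := F) hζ'
  set ψ := traceChar F p hζ'.pow_eq_one
  obtain ⟨n, -, hn⟩ := FiniteField.card F p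
  have hcard : (Fintype.card F : 𝓞 K) = (p : 𝓞 K) ^ (n : ℕ) := by rw [hn, Nat.cast_pow]
  have hint := fun n : ℤ => IsCyclotomicExtension.Rat.zeta_sub_one_dvd_intCast_iff' (n := n) p hζ
  have hreal (a : F) : ∃ r : ℝ, φ (binomialSum ψ d a) = r := by
    obtain ⟨r, hr⟩ := exists_ofReal_eq_binomialSum (ψ := φ.toMonoidHom.compAddChar ψ) hneg a
    exact ⟨r, by rw [← hr]; simp [binomialSum]⟩
  choose r hr using hreal
  have hunits (k : ℕ) (hk : k ≠ 0) :
      ∑ a : Fˣ, binomialSum ψ d a ^ k = ∑ a : F, binomialSum ψ d a ^ k := by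
    refine sum_of_injOn (fun a : Fˣ => (a : F)) (fun a _ b _ h => Units.ext h)
      (fun _ _ => mem_coe.mpr (mem_univ _)) (fun a _ ha => ?_) fun _ _ => rfl
    have ha0 : a = 0 := by
      by_contra h
      exact ha ⟨Units.mk0 a h, mem_coe.mpr (mem_univ _), rfl⟩
    rw [ha0, binomialSum_zero hψ hbij, zero_pow hk]
  have hchar (σ : Gal(K/ℚ)) :
      (((IsCyclotomicExtension.Rat.galEquivZMod p K σ).val.val : ℕ) : F) ≠ 0 := by
    rw [Ne, CharP.cast_eq_zero_iff F p, ← ZMod.natCast_eq_zero_iff, ZMod.natCast_zmod_val]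
    exact Units.ne_zero _
  refine false_of_three_nonzero_values (Γ := Gal(K/ℚ)) (G := Fˣ) (r := fun a => r a)
    hζ.zeta_sub_one_prime' (IsCyclotomicExtension.Rat.associated_zeta_sub_one_pow_prime p hζ)
    hint (fun σ => ?_) hφ (fun a => hr a)
    (fun σ => ?_) (n := n) ?_ ?_ ?_ ?_ (fun a => ?_)
    hAB hAC hBC hrange hA0 hB0 hC0 hvAB hvBC
  · exact hζ'.associated_sub_one_map_sub_one
      (MulSemiringAction.toAlgEquiv ℤ (𝓞 K) σ)
  · obtain ⟨c, hc⟩ := map_binomialSum_of_map_eq_pow (ψ := ψ) hbij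
      (σ := MulSemiringAction.toRingHom _ (𝓞 K) σ)
      (k := (IsCyclotomicExtension.Rat.galEquivZMod p K σ).val.val) (hchar σ)
      (fun x => IsCyclotomicExtension.Rat.galEquivZMod_smul_of_pow_eq p K σ
        (traceChar_pow_eq_one hζ'.pow_eq_one x))
    exact ⟨Equiv.mulLeft c, fun a => hc a⟩
  · rw [← hn, Fintype.card_units]
    exact Nat.sub_add_cancel Fintype.card_pos
  · simpa [← hcard, sum_binomialSum hψ hd] using hunits 1 one_ne_zero
  · rw [hunits 2 two_ne_zero, sum_binomialSum_sq hψ hneg, hcard]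
  · rw [hunits 3 three_ne_zero, ← hcard]
    exact sum_binomialSum_cube hψ hbij
  · refine dvd_binomialSum (sub_one_dvd_traceChar_sub_one hζ'.pow_eq_one) ?_ _
    rw [hcard, ← Int.cast_natCast, ← Int.cast_pow, hint]
    exact dvd_pow_self _ n.ne_zero

end Cyclotomic

/-- If `W_{F,d}` is three-valued, then `W_{F,d}(a) = 0` for some nonzero `a ∈ F`. -/
theorem weilSum_zero_of_three_valued (F : Type*) [Field F] [Fintype F]
    (p : ℕ) [Fact p.Prime] [CharP F p] (d : ℕ) (hd : 0 < d)
    (hgcd : Nat.gcd d (Fintype.card F - 1) = 1)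
    (h3 : Set.ncard {w : ℂ | ∃ a : F, a ≠ 0 ∧ weilSum F p d a = w} = 3) :
    ∃ a : F, a ≠ 0 ∧ weilSum F p d a = 0 := by
  have : NeZero (p : ℚ) := ⟨by exact_mod_cast (Fact.out : p.Prime).ne_zero⟩
  have hcyc := CyclotomicField.isCyclotomicExtension p ℚ
  have : IsCyclotomicExtension {p} ℚ (CyclotomicField p ℚ) := by exact hcyc
  have hζ := IsCyclotomicExtension.zeta_spec p ℚ (CyclotomicField p ℚ)
  set ζ := IsCyclotomicExtension.zeta p ℚ (CyclotomicField p ℚ)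
  have hη := Complex.isPrimitiveRoot_exp p (Fact.out : p.Prime).ne_zero
  obtain ⟨Φ, hΦ⟩ := hζ.exists_algHom_apply_eq hη
  let φ : NumberField.RingOfIntegers (CyclotomicField p ℚ) →+* ℂ :=
    Φ.toRingHom.comp (algebraMap _ (CyclotomicField p ℚ))
  have hφ : Function.Injective φ :=
    Φ.toRingHom.injective.comp NumberField.RingOfIntegers.coe_injective
  set ψ := traceChar F p hζ.toInteger_isPrimitiveRoot.pow_eq_one
  have hw (a : F) : φ (binomialSum ψ d a) = weilSum F p d a := by
    rw [binomialSum, map_sum, weilSum]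
    exact Finset.sum_congr rfl fun x _ => map_traceChar hζ.toInteger_isPrimitiveRoot.pow_eq_one hΦ _
  by_contra! hne
  have hS : {w : ℂ | ∃ a : F, a ≠ 0 ∧ weilSum F p d a = w} =
      φ '' Set.range fun a : Fˣ => binomialSum ψ d a := by
    ext w
    constructor
    · rintro ⟨a, ha, rfl⟩
      exact ⟨_, ⟨Units.mk0 a ha, rfl⟩, hw a⟩
    · rintro ⟨_, ⟨a, rfl⟩, rfl⟩
      exact ⟨a, a.ne_zero, (hw a).symm⟩
  rw [hS, Set.ncard_image_of_injective _ hφ] at h3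
  have h0 : ∀ x ∈ Set.range fun a : Fˣ => binomialSum ψ d a, x ≠ 0 := by
    rintro _ ⟨a, rfl⟩ h
    refine hne a a.ne_zero ?_
    rw [← hw]
    exact (congrArg φ h).trans (map_zero φ)
  obtain ⟨A, B, C, hAB, hAC, hBC, hrange⟩ := Set.ncard_eq_three.mp h3
  let v := multiplicity (hζ.toInteger - 1)
  have hmem : ∀ x ∈ ({A, B, C} : Set _), x ≠ 0 := by rwa [← hrange]
  have hsorted (x y z : NumberField.RingOfIntegers (CyclotomicField p ℚ)) (hxy : x ≠ y)
      (hxz : x ≠ z) (hyz : y ≠ z) (hset : ({A, B, C} : Set _) = {x, y, z})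
      (hvxy : v x ≤ v y) (hvyz : v y ≤ v z) : False := by
    rw [hset] at hmem hrange
    exact not_three_nonzero_values hζ hd hgcd hφ hxy hxz hyz hrange
      (hmem x (by simp)) (hmem y (by simp)) (hmem z (by simp)) hvxy hvyz
  rcases le_total (v A) (v B) with h | h
  · rcases le_total (v B) (v C) with h' | h'
    · exact hsorted A B C hAB hAC hBC rfl h h'
    · rcases le_total (v A) (v C) with h'' | h''
      · exact hsorted A C B hAC hAB hBC.symm (by grind) h'' h'
      · exact hsorted C A B hAC.symm hBC.symm hAB (by grind) h'' h
  · rcases le_total (v A) (v C) with h' | h'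
    · exact hsorted B A C hAB.symm hBC hAC (by grind) h h'
    · rcases le_total (v B) (v C) with h'' | h''
      · exact hsorted B C A hBC hAB.symm hAC.symm (by grind) h'' h'
      · exact hsorted C B A hBC.symm hAC.symm hAB.symm (by grind) h'' h
end

section
/- Let F be a finite field of characteristic p ∈ {2, 3} and order q = p^n where n is a power of 2. Then for every invertible exponent d over F, the Weil spectrum {W_{F,d}(a) : a ∈ F, a ≠ 0} does not have exactly three distinct elements. -/
open scoped BigOperators

/-- The sum `∑ x, ψ (x ^ d - a * x)` attached to an arbitrary additive character `ψ`. -/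
noncomputable def powSum {F : Type*} [Field F] [Fintype F] (ψ : AddChar F ℂ) (d : ℕ) (a : F) : ℂ :=
  ∑ x : F, ψ (x ^ d - a * x)

theorem neg_pow_of_injective {F : Type*} [Field F] {d : ℕ}
    (hd : Function.Injective fun x : F => x ^ d) (x : F) :
    (-x) ^ d = -x ^ d := by
  have h1 : ((-1 : F) ^ d) = -1 := by
    have h2 : ((-1 : F) ^ d) * ((-1 : F) ^ d) = 1 := by rw [← mul_pow]; simp
    rcases mul_self_eq_one_iff.mp h2 with h | h
    · have : (-1 : F) = 1 := hd (by simp [h])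
      rw [h, this]
    · exact h
  rw [neg_pow, h1]; ring

theorem zero_pow_of_injective {F : Type*} [Field F] {d : ℕ}
    (hd : Function.Injective fun x : F => x ^ d) : (0 : F) ^ d = 0 := by
  rcases Nat.eq_zero_or_pos d with h | h
  · subst h
    exact absurd (hd (a₁ := 0) (a₂ := 1) (by simp)) (by simp)
  · exact zero_pow h.ne'

section Moments

variable {F : Type*} [Field F] [Fintype F] {ψ : AddChar F ℂ} {d : ℕ}

open Classical in
theorem AddChar.sum_mul_eq_ite (hψ : ψ ≠ 1) (t : F) :
    ∑ a : F, ψ (a * t) = if t = 0 then (Fintype.card F : ℂ) else 0 := by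
  have h := AddChar.sum_mulShift t (AddChar.IsPrimitive.of_ne_one hψ)
  rw [h]; split_ifs <;> simp

theorem sum_comp_pow (hd : Function.Injective fun x : F => x ^ d) (f : F → ℂ) :
    ∑ x : F, f (x ^ d) = ∑ x, f x :=
  (Equiv.ofBijective _ (Finite.injective_iff_bijective.mp hd)).sum_comp f

theorem powSum_eq_neg (hd : Function.Injective fun x : F => x ^ d) (a : F) :
    powSum ψ d a = ∑ x : F, ψ (a * x - x ^ d) := by
  rw [powSum, ← Equiv.sum_comp (Equiv.neg F) fun x : F => ψ (x ^ d - a * x)]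
  refine Finset.sum_congr rfl fun x _ => ?_
  simp only [Equiv.neg_apply, neg_pow_of_injective hd]
  congr 1; ring

theorem powSum_zero (hψ : ψ ≠ 1) (hd : Function.Injective fun x : F => x ^ d) :
    powSum ψ d 0 = 0 := by
  simp only [powSum, zero_mul, sub_zero]
  rw [sum_comp_pow hd ψ]
  exact AddChar.sum_eq_zero_of_ne_one hψ

theorem sum_powSum_mul (hψ : ψ ≠ 1) (x : F) :
    ∑ a : F, powSum ψ d a * ψ (a * x) = Fintype.card F * ψ (x ^ d) := by
  classical
  have h : ∀ a y : F, ψ (y ^ d - a * y) * ψ (a * x) = ψ (y ^ d) * ψ (a * (x - y)) := by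
    intro a y
    rw [← AddChar.map_add_eq_mul, ← AddChar.map_add_eq_mul]; congr 1; ring
  simp only [powSum, Finset.sum_mul, h]
  rw [Finset.sum_comm]
  simp only [← Finset.mul_sum, AddChar.sum_mul_eq_ite hψ, sub_eq_zero]
  simp [mul_comm]

theorem sum_powSum (hψ : ψ ≠ 1) (hd : Function.Injective fun x : F => x ^ d) :
    ∑ a : F, powSum ψ d a = Fintype.card F := by
  simpa [zero_pow_of_injective hd] using sum_powSum_mul (d := d) hψ 0

open Classical in
theorem sum_powSum_mul_powSum (hψ : ψ ≠ 1) (hd : Function.Injective fun x : F => x ^ d)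
    {a b : F} (hb : b ≠ 0) :
    ∑ c : F, powSum ψ d (c * a) * powSum ψ d (c * b)
      = if a = b then (Fintype.card F : ℂ) ^ 2 else 0 := by
  have h1 : ∀ c : F, powSum ψ d (c * a) * powSum ψ d (c * b)
      = ∑ x : F, ψ (x ^ d) * ∑ y : F, ψ (-y ^ d) * ψ (c * (b * y - a * x)) := by
    intro c
    rw [powSum_eq_neg hd (c * b), powSum, Finset.sum_mul_sum]
    refine Finset.sum_congr rfl fun x _ => ?_
    rw [Finset.mul_sum]
    refine Finset.sum_congr rfl fun y _ => ?_
    simp only [← AddChar.map_add_eq_mul]; congr 1; ring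
  simp only [h1]
  rw [Finset.sum_comm]
  have h2 : ∀ x : F, ∑ c : F, ψ (x ^ d) * ∑ y : F, ψ (-y ^ d) * ψ (c * (b * y - a * x))
      = Fintype.card F * ψ (x ^ d * (1 - (a / b) ^ d)) := by
    intro x
    rw [← Finset.mul_sum, Finset.sum_comm]
    simp only [← Finset.mul_sum, AddChar.sum_mul_eq_ite hψ]
    have h3 : ∀ y : F, b * y - a * x = 0 ↔ y = a / b * x := by
      intro y
      rw [sub_eq_zero]; constructor
      · intro h; field_simp; linear_combination h
      · rintro rfl; field_simp
    simp only [h3]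
    simp only [mul_ite, mul_zero, Finset.sum_ite_eq', Finset.mem_univ, if_true]
    rw [← mul_assoc, ← AddChar.map_add_eq_mul, mul_comm]
    congr 2; rw [mul_pow]; ring
  simp only [h2]
  rw [← Finset.mul_sum, sum_comp_pow hd (fun x => ψ (x * (1 - (a / b) ^ d))),
    AddChar.sum_mul_eq_ite hψ]
  have h4 : 1 - (a / b) ^ d = 0 ↔ a = b := by
    rw [sub_eq_zero]; constructor
    · intro h
      have : a / b = 1 := hd (by simp [← h])
      exact (div_eq_one_iff_eq hb).mp this
    · rintro rfl; simp [div_self hb]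
  simp only [h4]
  split_ifs <;> ring

open Classical in
/-- The number of `x` with `x ^ d + (c - x) ^ d = 1`. -/
noncomputable def fiberCount {F : Type*} [Field F] [Fintype F] (d : ℕ) (c : F) : ℕ :=
  (Finset.univ.filter fun x : F => x ^ d + (c - x) ^ d = 1).card

theorem sum_fiberCount (hd : Function.Injective fun x : F => x ^ d) :
    ∑ c : F, fiberCount d c = Fintype.card F := by
  classical
  simp only [fiberCount, Finset.card_filter]
  rw [Finset.sum_comm]
  have h : ∀ x : F, ∑ c : F, (if x ^ d + (c - x) ^ d = 1 then 1 else 0) = 1 := by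
    intro x
    rw [← Equiv.sum_comp (Equiv.addRight x)
      fun c : F => if x ^ d + (c - x) ^ d = 1 then 1 else 0]
    simp only [Equiv.coe_addRight, add_sub_cancel_right]
    obtain ⟨y, hy⟩ := (Finite.injective_iff_bijective.mp hd).2 (1 - x ^ d)
    simp only at hy
    have : ∀ z : F, x ^ d + z ^ d = 1 ↔ z = y := by
      intro z
      constructor
      · intro hz
        apply hd
        simp only [hy]
        linear_combination hz
      · rintro rfl; rw [hy]; ring
    simp [this]
  simp [h]

theorem sum_sq_powSum_mul_powSum (hψ : ψ ≠ 1) (hd : Function.Injective fun x : F => x ^ d)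
    (c : F) :
    ∑ a : F, powSum ψ d a ^ 2 * powSum ψ d (a * c)
      = (Fintype.card F : ℂ) ^ 2 * fiberCount d c := by
  classical
  have h1 : ∀ a : F, powSum ψ d a ^ 2 * powSum ψ d (a * c)
      = ∑ z : F, ∑ x : F, ∑ y : F, ψ (x ^ d + y ^ d - z ^ d) * ψ (a * (c * z - x - y)) := by
    intro a
    rw [powSum_eq_neg hd (a * c), powSum, sq, Finset.sum_mul_sum, Finset.mul_sum]
    refine Finset.sum_congr rfl fun z _ => ?_
    rw [Finset.sum_mul]
    refine Finset.sum_congr rfl fun x _ => ?_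
    rw [Finset.sum_mul]
    refine Finset.sum_congr rfl fun y _ => ?_
    simp only [← AddChar.map_add_eq_mul]; congr 1; ring
  simp only [h1]
  rw [Finset.sum_comm]
  have h2 : ∀ z : F, ∑ a : F, ∑ x : F, ∑ y : F,
      ψ (x ^ d + y ^ d - z ^ d) * ψ (a * (c * z - x - y))
      = Fintype.card F * ∑ x : F, ψ (x ^ d + (c * z - x) ^ d - z ^ d) := by
    intro z
    rw [Finset.sum_comm, Finset.mul_sum]
    refine Finset.sum_congr rfl fun x _ => ?_
    rw [Finset.sum_comm]
    simp only [← Finset.mul_sum, AddChar.sum_mul_eq_ite hψ, sub_eq_zero]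
    simp [mul_comm]
  simp only [h2]
  rw [← Finset.mul_sum]
  have h3 : ∀ z : F, ∑ x : F, ψ (x ^ d + (c * z - x) ^ d - z ^ d)
      = ∑ x : F, ψ (z ^ d * (x ^ d + (c - x) ^ d - 1)) := by
    intro z
    by_cases hz : z = 0
    · subst hz
      simp [zero_pow_of_injective hd, neg_pow_of_injective hd]
    · rw [← Equiv.sum_comp (Equiv.mulLeft₀ z hz)
        fun x : F => ψ (x ^ d + (c * z - x) ^ d - z ^ d)]
      refine Finset.sum_congr rfl fun x _ => ?_
      simp only [Equiv.mulLeft₀_apply]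
      congr 1
      rw [show c * z - z * x = z * (c - x) by ring, mul_pow, mul_pow]; ring
  simp only [h3]
  rw [sum_comp_pow hd (fun z => ∑ x : F, ψ (z * (x ^ d + (c - x) ^ d - 1))), Finset.sum_comm]
  simp only [AddChar.sum_mul_eq_ite hψ, sub_eq_zero, fiberCount]
  rw [← Finset.sum_filter, Finset.sum_const, nsmul_eq_mul]
  ring

end Moments

section Integrality

variable {F : Type*} [Field F] [Fintype F] {ψ : AddChar F ℂ} {d p : ℕ}

theorem exists_int_cast_eq_powSum [CharP F p] (hp : p = 2 ∨ p = 3)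
    (hd : Function.Injective fun x : F => x ^ d) :
    ∃ w : F → ℤ, ∀ a, (w a : ℂ) = powSum ψ d a := by
  have hpow : ∀ x : F, ψ x ^ p = 1 := by
    intro x
    rw [← AddChar.map_nsmul_eq_pow, nsmul_eq_mul, CharP.cast_eq_zero, zero_mul,
      AddChar.map_zero_eq_one]
  have hadd : ∀ x : F, ∃ m : ℤ, ψ x + ψ (-x) = m := by
    intro x
    have h1 := hpow x
    have h2 : ψ x * ψ (-x) = 1 := by
      rw [← AddChar.map_add_eq_mul, add_neg_cancel, AddChar.map_zero_eq_one]
    have h0 : ψ x ≠ 0 := left_ne_zero_of_mul_eq_one h2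
    have h3 : ψ (-x) = (ψ x) ^ 2 ∨ ψ (-x) = ψ x := by
      rcases hp with rfl | rfl
      · right; apply mul_left_cancel₀ h0; rw [h2, ← h1, sq]
      · left; apply mul_left_cancel₀ h0; rw [h2, ← h1]; ring
    have h4 : ψ x = 1 ∨ ψ x = -1 ∨ ψ x ^ 2 + ψ x + 1 = 0 := by
      rcases hp with rfl | rfl
      · rw [sq] at h1
        rcases mul_self_eq_one_iff.mp h1 with h | h <;> simp [h]
      · have : (ψ x - 1) * (ψ x ^ 2 + ψ x + 1) = 0 := by linear_combination h1
        rcases mul_eq_zero.mp this with h | h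
        · left; linear_combination h
        · right; right; exact h
    rcases h4 with h | h | h
    · exact ⟨2, by rw [h] at h2 ⊢; push_cast; linear_combination h2⟩
    · exact ⟨-2, by rw [h] at h2 ⊢; push_cast; linear_combination -h2⟩
    · refine ⟨-1, ?_⟩
      have : ψ x * (ψ x + ψ (-x) + 1) = 0 := by linear_combination h + h2
      have := (mul_eq_zero.mp this).resolve_left h0
      push_cast; linear_combination this
  choose m hm using hadd
  have hint : ∀ a, ∃ k : ℤ, (k : ℂ) = powSum ψ d a := by
    intro a
    have h2 : 2 * powSum ψ d a = ((∑ x : F, m (x ^ d - a * x) : ℤ) : ℂ) := by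
      rw [two_mul]
      nth_rewrite 2 [powSum_eq_neg hd]
      rw [powSum, ← Finset.sum_add_distrib]
      push_cast
      refine Finset.sum_congr rfl fun x _ => ?_
      rw [← hm, neg_sub]
    have h3 : IsIntegral ℤ (powSum ψ d a) := by
      refine IsIntegral.sum _ fun x _ => ?_
      refine IsIntegral.of_pow (n := p) (by rcases hp with rfl | rfl <;> norm_num) ?_
      rw [hpow]; exact isIntegral_one
    set N : ℤ := ∑ x : F, m (x ^ d - a * x)
    have h4 : powSum ψ d a = algebraMap ℚ ℂ ((N : ℚ) / 2) := by
      simp only [map_div₀, map_intCast, map_ofNat]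
      rw [← h2]; ring
    rw [h4, isIntegral_algebraMap_iff (algebraMap ℚ ℂ).injective] at h3
    obtain ⟨k, hk⟩ := IsIntegrallyClosed.isIntegral_iff.mp h3
    refine ⟨k, ?_⟩
    rw [h4, ← hk]; simp
  choose w hw using hint
  exact ⟨w, hw⟩

/-- The power moment identities satisfied by an integer-valued Weil sum `w` on a field,
with `T c` the number of solutions of the associated equation. -/
structure HasWeilMoments (w : F → ℤ) (T : F → ℕ) : Prop where
  map_zero : w 0 = 0
  sum_eq : ∑ a, w a = Fintype.card F
  corr_self : ∀ a, a ≠ 0 → ∑ c, w (c * a) * w (c * a) = (Fintype.card F : ℤ) ^ 2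
  corr_ne : ∀ a b, b ≠ 0 → a ≠ b → ∑ c, w (c * a) * w (c * b) = 0
  sum_sq_mul : ∀ c, ∑ a, w a ^ 2 * w (a * c) = (Fintype.card F : ℤ) ^ 2 * T c
  sum_count : ∑ c, T c = Fintype.card F

theorem hasWeilMoments_of_cast_eq (hψ : ψ ≠ 1) (hd : Function.Injective fun x : F => x ^ d)
    {w : F → ℤ} (hw : ∀ a, (w a : ℂ) = powSum ψ d a) : HasWeilMoments w (fiberCount d) where
  map_zero := by
    have := hw 0
    rw [powSum_zero hψ hd] at this
    exact_mod_cast this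
  sum_eq := by
    have := sum_powSum hψ hd
    simp only [← hw] at this
    exact_mod_cast this
  corr_self a ha := by
    have := sum_powSum_mul_powSum hψ hd (a := a) ha
    simp only [← hw, if_true] at this
    exact_mod_cast this
  corr_ne a b hb hab := by
    have := sum_powSum_mul_powSum hψ hd (a := a) hb
    simp only [← hw, if_neg hab] at this
    exact_mod_cast this
  sum_sq_mul c := by
    have := sum_sq_powSum_mul_powSum hψ hd c
    simp only [← hw] at this
    exact_mod_cast this
  sum_count := sum_fiberCount hd

/-- The character `x ↦ ψ (x ^ d)` coincides with a multiplicative shift of `ψ`. -/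
def IsDegenerate {F : Type*} [Field F] (ψ : AddChar F ℂ) (d : ℕ) : Prop :=
  ∃ a : F, a ≠ 0 ∧ ∀ x : F, ψ (x ^ d) = ψ (a * x)

theorem isDegenerate_of_nonneg (hψ : ψ ≠ 1) (hd : Function.Injective fun x : F => x ^ d)
    {w : F → ℤ} (hw : ∀ a, (w a : ℂ) = powSum ψ d a) (h0 : ∀ a, 0 ≤ w a) :
    IsDegenerate ψ d := by
  have H := hasWeilMoments_of_cast_eq hψ hd hw
  obtain ⟨a, -, ha⟩ : ∃ a ∈ Finset.univ, w a ≠ 0 := by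
    apply Finset.exists_ne_zero_of_sum_ne_zero
    rw [H.sum_eq]
    exact_mod_cast Fintype.card_ne_zero
  have ha0 : a ≠ 0 := by rintro rfl; exact ha H.map_zero
  have hz : ∀ b, b ≠ a → w b = 0 := by
    intro b hb
    by_cases hb0 : b = 0
    · rw [hb0, H.map_zero]
    have h1 := H.corr_ne a b hb0 (Ne.symm hb)
    rw [Finset.sum_eq_zero_iff_of_nonneg fun c _ => mul_nonneg (h0 _) (h0 _)] at h1
    have := h1 1 (Finset.mem_univ _)
    rw [one_mul, one_mul] at this
    exact (mul_eq_zero.mp this).resolve_left ha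
  refine ⟨a, ha0, fun x => ?_⟩
  have hinv : ∀ y : F, (w a : ℂ) * ψ (a * y) = Fintype.card F * ψ (y ^ d) := by
    intro y
    rw [← sum_powSum_mul hψ, Finset.sum_eq_single a, ← hw]
    · intro b _ hb; rw [← hw, hz b hb]; simp
    · simp
  have hwa := hinv 0
  rw [mul_zero, AddChar.map_zero_eq_one, mul_one, zero_pow_of_injective hd,
    AddChar.map_zero_eq_one, mul_one] at hwa
  have := hinv x
  rw [hwa] at this
  exact (mul_left_cancel₀ (by exact_mod_cast Fintype.card_ne_zero) this).symm

theorem powSum_of_isDegenerate (hψ : ψ ≠ 1) (h : IsDegenerate ψ d) (b : F) :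
    powSum ψ d b = 0 ∨ powSum ψ d b = Fintype.card F := by
  classical
  obtain ⟨a, -, h⟩ := h
  have : powSum ψ d b = ∑ x : F, ψ (x * (a - b)) := by
    refine Finset.sum_congr rfl fun x _ => ?_
    rw [sub_eq_add_neg, AddChar.map_add_eq_mul, h, ← AddChar.map_add_eq_mul]
    congr 1; ring
  rw [this, AddChar.sum_mul_eq_ite hψ]
  split_ifs <;> simp

end Integrality

section FiberCount

variable {F : Type*} [Field F] [Fintype F] {d : ℕ}

theorem two_dvd_fiberCount_one [CharP F 2] : 2 ∣ fiberCount d (1 : F) := by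
  classical
  have h2 : (2 : F) = 0 := CharP.cast_eq_zero F 2
  let f : Function.End {x : F // x ^ d + (1 - x) ^ d = 1} :=
    fun x => ⟨1 - x.1, by rw [sub_sub_cancel, add_comm]; exact x.2⟩
  have hf : f ^ 2 ^ 1 = 1 := by
    funext x
    apply Subtype.ext
    change 1 - (1 - x.1) = x.1
    ring
  have h := Equiv.Perm.card_fixedPoints_modEq (p := 2) hf
  have he : IsEmpty f.fixedPoints := by
    refine ⟨fun ⟨x, hx⟩ => ?_⟩
    have h1 : 1 - x.1 = x.1 := congrArg Subtype.val hx
    exact one_ne_zero (α := F) (by linear_combination h1 + x.1 * h2)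
  rw [Fintype.card_eq_zero (α := f.fixedPoints), Fintype.card_subtype] at h
  exact (Nat.modEq_zero_iff_dvd.mp h)

theorem three_dvd_fiberCount_one [CharP F 3] (hd : Function.Injective fun x : F => x ^ d) :
    3 ∣ fiberCount d (1 : F) := by
  classical
  have h3 : (3 : F) = 0 := CharP.cast_eq_zero F 3
  have hz := zero_pow_of_injective hd
  have hneg := neg_pow_of_injective hd
  let S := {x : F // x ^ d + (1 - x) ^ d = 1 ∧ x ≠ 0 ∧ x ≠ 1}
  let f : Function.End S := fun x => ⟨(1 - x.1)⁻¹, by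
    obtain ⟨x, hx, hx0, hx1⟩ := x
    have h1 : 1 - x ≠ 0 := sub_ne_zero.mpr (Ne.symm hx1)
    refine ⟨?_, inv_ne_zero h1, ?_⟩
    · have h2 : 1 - (1 - x)⁻¹ = (-x) * (1 - x)⁻¹ := by field_simp; ring
      simp only
      rw [h2, mul_pow, hneg, inv_pow]
      have h4 : (1 - x) ^ d ≠ 0 := pow_ne_zero _ h1
      field_simp
      linear_combination -hx
    · simp only
      intro h
      rw [inv_eq_one] at h
      exact hx0 (by linear_combination -h)⟩
  have hf : f ^ 3 ^ 1 = 1 := by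
    funext x
    apply Subtype.ext
    change (1 - (1 - (1 - x.1)⁻¹)⁻¹)⁻¹ = x.1
    obtain ⟨x, hx, hx0, hx1⟩ := x
    simp only
    have h1 : 1 - x ≠ 0 := sub_ne_zero.mpr (Ne.symm hx1)
    have h2 : 1 - (1 - x)⁻¹ = (-x) * (1 - x)⁻¹ := by field_simp; ring
    have h4 : 1 - ((-x) * (1 - x)⁻¹)⁻¹ = x⁻¹ := by
      have : -x ≠ 0 := neg_ne_zero.mpr hx0
      field_simp; ring
    rw [h2, h4, inv_inv]
  have h := Equiv.Perm.card_fixedPoints_modEq (p := 3) hf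
  have hm1 : (-1 : F) ≠ 1 := by
    intro h
    exact one_ne_zero (α := F) (by linear_combination h3 + h)
  let e : S := ⟨-1, by
    refine ⟨?_, neg_ne_zero.mpr one_ne_zero, hm1⟩
    have : (1 : F) - -1 = -1 := by linear_combination h3
    rw [this, hneg, one_pow]
    linear_combination -h3⟩
  have hfix : Fintype.card f.fixedPoints = 1 := by
    rw [Fintype.card_eq_one_iff]
    refine ⟨⟨e, Subtype.ext ?_⟩, fun ⟨⟨x, hx, hx0, hx1⟩, hxf⟩ => ?_⟩
    · change (1 - (-1 : F))⁻¹ = -1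
      have : (1 : F) - -1 = -1 := by linear_combination h3
      rw [this, inv_neg, inv_one]
    · have h1 : (1 - x)⁻¹ = x := congrArg Subtype.val hxf
      have h2 : 1 - x ≠ 0 := sub_ne_zero.mpr (Ne.symm hx1)
      have h4 : (x + 1) ^ 2 = 0 := by
        have : 1 = x * (1 - x) := by
          nth_rewrite 1 [← inv_mul_cancel₀ h2]
          rw [h1]
        linear_combination this + x * h3
      apply Subtype.ext
      apply Subtype.ext
      change x = -1
      linear_combination pow_eq_zero_iff (two_ne_zero) |>.mp h4
  rw [hfix] at h
  have hcard : fiberCount d (1 : F) = Fintype.card S + 2 := by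
    rw [Fintype.card_subtype, fiberCount]
    have : (Finset.univ.filter fun x : F => x ^ d + (1 - x) ^ d = 1)
        = (Finset.univ.filter fun x : F => x ^ d + (1 - x) ^ d = 1 ∧ x ≠ 0 ∧ x ≠ 1)
          ∪ {0, 1} := by
      ext x
      simp only [Finset.mem_filter, Finset.mem_univ, true_and, Finset.mem_union,
        Finset.mem_insert, Finset.mem_singleton]
      constructor
      · intro hx; tauto
      · rintro (⟨hx, -⟩ | rfl | rfl)
        · exact hx
        · simp [hz]
        · simp [hz]
    rw [this, Finset.card_union_of_disjoint, Finset.card_pair zero_ne_one]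
    rw [Finset.disjoint_left]
    intro x hx
    simp only [Finset.mem_filter] at hx
    simp only [Finset.mem_insert, Finset.mem_singleton]
    tauto
  rw [hcard]
  have h5 : Fintype.card S % 3 = 1 := h
  omega

end FiberCount

section Arithmetic

theorem Int.exists_eq_prime_pow_mul {p : ℕ} (hp : p.Prime) {a : ℤ} (ha : a ≠ 0) :
    ∃ (x : ℕ) (b : ℤ), ¬ (p : ℤ) ∣ b ∧ a = p ^ x * b := by
  have hf : FiniteMultiplicity (p : ℤ) a :=
    Int.finiteMultiplicity_iff.mpr ⟨by simpa using hp.ne_one, ha⟩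
  obtain ⟨b, hb, hpb⟩ := hf.exists_eq_pow_mul_and_not_dvd
  exact ⟨_, b, hpb, hb⟩

theorem Int.pow_dvd_prime_pow_mul {p : ℕ} (hp : p.Prime) {k x : ℕ} {b : ℤ}
    (hb : ¬ (p : ℤ) ∣ b) (h : (p : ℤ) ^ k ∣ p ^ x * b) : k ≤ x := by
  by_contra! hlt
  have hp0 : (p : ℤ) ≠ 0 := by exact_mod_cast hp.ne_zero
  have h1 : (p : ℤ) ^ x * p ∣ p ^ x * b := by
    rw [← pow_succ]; exact (pow_dvd_pow _ hlt).trans h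
  exact hb ((mul_dvd_mul_iff_left (pow_ne_zero _ hp0)).mp h1)

theorem Int.dvd_of_dvd_prime_pow_mul {p : ℕ} (hp : p.Prime) {k : ℕ} {b t : ℤ}
    (hb : ¬ (p : ℤ) ∣ b) (h : b ∣ p ^ k * t) : b ∣ t := by
  have hpp : Prime (p : ℤ) := Nat.prime_iff_prime_int.mp hp
  have : IsCoprime ((p : ℤ) ^ k) b := (hpp.coprime_iff_not_dvd.mpr hb).pow_left
  exact this.symm.dvd_of_dvd_mul_left h

theorem Int.prime_pow_le_abs_mul {p : ℕ} {k x : ℕ} (hp : p.Prime) (hkx : k ≤ x)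
    {b : ℤ} (hb : ¬ (p : ℤ) ∣ b) : (p : ℤ) ^ k ≤ |(p : ℤ) ^ x * b| := by
  have hp1 : (1 : ℤ) ≤ p := by exact_mod_cast hp.one_le
  have h1 : 1 ≤ |b| := Int.one_le_abs (by rintro rfl; exact hb (dvd_zero _))
  rw [abs_mul, abs_of_nonneg (by positivity : (0 : ℤ) ≤ (p : ℤ) ^ x)]
  calc (p : ℤ) ^ k ≤ p ^ x := pow_le_pow_right₀ hp1 hkx
    _ ≤ p ^ x * |b| := le_mul_of_one_le_right (by positivity) h1

/-- Lower bounds for the products of three small integers satisfying a cubic moment identity. -/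
theorem two_mul_prime_pow_le_abs_mul {p n : ℕ} (hp : p.Prime) (hn : n ≠ 0) {A B C X : ℤ}
    (hA0 : A ≠ 0) (hB0 : B ≠ 0) (hC0 : C ≠ 0)
    (hA : |A| < p ^ n) (hB : |B| < p ^ n) (hC : |C| < p ^ n)
    (h : A * B * C * (p ^ n - 1) = (p ^ n) ^ 2 * X + p ^ n * (A * B + B * C + C * A)) :
    2 * (p : ℤ) ^ n ≤ |A * B| ∧ 2 * (p : ℤ) ^ n ≤ |B * C| ∧ 2 ≤ |A| ∧ 2 ≤ |B| ∧ 2 ≤ |C| := by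
  obtain ⟨x, a, ha, rfl⟩ := Int.exists_eq_prime_pow_mul hp hA0
  obtain ⟨y, b, hb, rfl⟩ := Int.exists_eq_prime_pow_mul hp hB0
  obtain ⟨z, c, hc, rfl⟩ := Int.exists_eq_prime_pow_mul hp hC0
  have hpp : Prime (p : ℤ) := Nat.prime_iff_prime_int.mp hp
  have hp2 : (2 : ℤ) ≤ p := by exact_mod_cast hp.two_le
  have hp1 : (1 : ℤ) < p := by linarith
  have hxn : x < n := (pow_lt_pow_iff_right₀ hp1).mp
    ((Int.prime_pow_le_abs_mul hp le_rfl ha).trans_lt hA)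
  have hyn : y < n := (pow_lt_pow_iff_right₀ hp1).mp
    ((Int.prime_pow_le_abs_mul hp le_rfl hb).trans_lt hB)
  have hzn : z < n := (pow_lt_pow_iff_right₀ hp1).mp
    ((Int.prime_pow_le_abs_mul hp le_rfl hc).trans_lt hC)
  have hq1 : ¬ (p : ℤ) ∣ p ^ n - 1 := by
    intro hd
    have := (Int.dvd_iff_dvd_of_dvd_sub hd).mp (dvd_pow_self _ hn)
    exact hpp.not_dvd_one this
  have hsum : 2 * n ≤ x + y + z := by
    by_contra! hlt
    have hunit : ¬ (p : ℤ) ∣ a * b * c * (p ^ n - 1) :=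
      hpp.not_dvd_mul (hpp.not_dvd_mul (hpp.not_dvd_mul ha hb) hc) hq1
    have hdvd : (p : ℤ) ^ (x + y + z + 1) ∣ p ^ (x + y + z) * (a * b * c * (p ^ n - 1)) := by
      have he : (p : ℤ) ^ (x + y + z) * (a * b * c * (p ^ n - 1))
          = p ^ (2 * n) * X + (p ^ (n + x + y) * (a * b) + p ^ (n + y + z) * (b * c)
            + p ^ (n + z + x) * (c * a)) := by
        simp only [pow_add, two_mul]
        linear_combination h
      rw [he]
      refine dvd_add ?_ (dvd_add (dvd_add ?_ ?_) ?_) <;>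
        exact Dvd.dvd.mul_right (pow_dvd_pow _ (by omega)) _
    have := Int.pow_dvd_prime_pow_mul hp hunit hdvd
    omega
  have hpair : ∀ {u v : ℕ} {e f : ℤ}, ¬ (p : ℤ) ∣ e → ¬ (p : ℤ) ∣ f → n + 1 ≤ u + v →
      2 * (p : ℤ) ^ n ≤ |(p : ℤ) ^ u * e * (p ^ v * f)| := by
    intro u v e f he hf huv
    have h1 := Int.prime_pow_le_abs_mul hp huv (hpp.not_dvd_mul he hf)
    rw [pow_succ] at h1
    have h2 : (p : ℤ) ^ u * e * (p ^ v * f) = p ^ (u + v) * (e * f) := by rw [pow_add]; ring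
    rw [h2]
    have : (0 : ℤ) < (p : ℤ) ^ n := by positivity
    nlinarith
  have hone : ∀ {u : ℕ} {e : ℤ}, ¬ (p : ℤ) ∣ e → 1 ≤ u → 2 ≤ |(p : ℤ) ^ u * e| := by
    intro u e he hu
    have h1 := Int.prime_pow_le_abs_mul hp hu he
    rw [pow_one] at h1; linarith
  exact ⟨hpair ha hb (by omega), hpair hb hc (by omega), hone ha (by omega), hone hb (by omega),
    hone hc (by omega)⟩

theorem prime_pow_dvd_of_moment_relations_aux {p n : ℕ} (hp : p.Prime) (hn : n ≠ 0)
    {A B t T : ℤ} (ht : 0 < t)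
    (hABt : (p : ℤ) ^ n * t ≤ -(A * B)) (hA : A * (A - B) ∣ ((p : ℤ) ^ n) ^ 2 * t)
    (hB : B * (B - A) ∣ ((p : ℤ) ^ n) ^ 2 * t) (hT : (p : ℤ) ∣ T)
    (hTeq : (p : ℤ) ^ n * T = (A + B) * p ^ n - A * B)
    (hg : ∀ g : ℤ, g ∣ A → g ∣ B → g ∣ (p : ℤ) ^ n)
    {x y : ℕ} {a b : ℤ} (ha : ¬ (p : ℤ) ∣ a) (hb : ¬ (p : ℤ) ∣ b)
    (hAx : A = p ^ x * a) (hBy : B = p ^ y * b) (hxy : x ≤ y) : n / 2 + 1 ≤ x := by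
  have hpp : Prime (p : ℤ) := Nat.prime_iff_prime_int.mp hp
  have hp1 : (1 : ℤ) < p := by exact_mod_cast hp.one_lt
  have hp0 : (0 : ℤ) < p := by linarith
  have hpn : (0 : ℤ) < (p : ℤ) ^ n := by positivity
  have hab : ¬ (p : ℤ) ∣ a * b := hpp.not_dvd_mul ha hb
  subst hAx hBy
  rcases hxy.eq_or_lt with rfl | hlt
  · have h1 : (p : ℤ) ^ (2 * x) * (a * b) = p ^ n * (p ^ x * (a + b) - T) := by
      rw [two_mul, pow_add]; linear_combination hTeq
    have hx : 1 ≤ x := by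
      have h2 : (p : ℤ) ^ 1 ∣ p ^ (2 * x) * (a * b) := by
        rw [h1, pow_one]; exact (dvd_pow_self _ hn).mul_right _
      have := Int.pow_dvd_prime_pow_mul hp hab h2
      omega
    have h3 : (p : ℤ) ^ (n + 1) ∣ p ^ (2 * x) * (a * b) := by
      rw [h1, pow_succ]
      exact mul_dvd_mul_left _ (dvd_sub ((dvd_pow_self _ (by omega)).mul_right _) hT)
    have := Int.pow_dvd_prime_pow_mul hp hab h3
    omega
  · set m : ℤ := a - p ^ (y - x) * b with hm
    have hyx : (p : ℤ) ^ y = p ^ x * p ^ (y - x) := by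
      rw [← pow_add]; congr 1; omega
    have hpm : ¬ (p : ℤ) ∣ m := by
      intro hd
      have h1 : (p : ℤ) ∣ p ^ (y - x) * b := (dvd_pow_self _ (by omega)).mul_right _
      have := dvd_add hd h1
      rw [hm, sub_add_cancel] at this
      exact ha this
    have ham : a * m ∣ t := by
      refine Int.dvd_of_dvd_prime_pow_mul hp (hpp.not_dvd_mul ha hpm) (k := n * 2) ?_
      rw [pow_mul]
      refine dvd_trans (Dvd.intro (p ^ x * p ^ x) ?_) hA
      rw [hm, hyx]; ring
    have hbm : b * m ∣ t := by
      refine Int.dvd_of_dvd_prime_pow_mul hp (hpp.not_dvd_mul hb hpm) (k := n * 2) ?_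
      rw [pow_mul]
      refine dvd_trans (Dvd.intro (-(p ^ y * p ^ x)) ?_) hB
      rw [hm, hyx]; ring
    have hcop : IsCoprime a b := by
      rw [Int.isCoprime_iff_gcd_eq_one]
      have h1 : ((Int.gcd a b : ℕ) : ℤ) ∣ a := Int.gcd_dvd_left ..
      have h2 : ((Int.gcd a b : ℕ) : ℤ) ∣ b := Int.gcd_dvd_right ..
      have h3 := hg _ (h1.mul_left (p ^ x)) (h2.mul_left (p ^ y))
      have h4 : ¬ (p : ℤ) ∣ ((Int.gcd a b : ℕ) : ℤ) := fun h => ha (h.trans h1)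
      have h5 : ((Int.gcd a b : ℕ) : ℤ) ∣ 1 :=
        Int.dvd_of_dvd_prime_pow_mul hp h4 (k := n) (by rwa [mul_one])
      exact Nat.dvd_one.mp (by exact_mod_cast h5)
    have hm0 : m ≠ 0 := by rintro h; rw [h] at hpm; exact hpm (dvd_zero _)
    have habm : a * b * m ∣ t := by
      obtain ⟨s, rfl⟩ := (dvd_mul_left m a).trans ham
      rw [mul_comm m s] at ham hbm ⊢
      exact mul_dvd_mul_right (hcop.mul_dvd ((mul_dvd_mul_iff_right hm0).mp ham)
        ((mul_dvd_mul_iff_right hm0).mp hbm)) _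
    have hle : |a * b * m| ≤ t := Int.le_of_dvd ht ((abs_dvd _ _).mpr habm)
    have hneg : a * b < 0 := by
      have h1 : 0 < (p : ℤ) ^ x * p ^ y := by positivity
      have h2 : (p : ℤ) ^ x * p ^ y * (a * b) < 0 := by nlinarith
      exact neg_of_mul_neg_right h2 h1.le
    have hprod : (p : ℤ) ^ n * |m| ≤ p ^ (x + y) := by
      have h1 : |a * b * m| = -(a * b) * |m| := by rw [abs_mul, abs_of_neg hneg]
      rw [h1] at hle
      have h2 : (p : ℤ) ^ n * (-(a * b) * |m|) ≤ p ^ (x + y) * -(a * b) := by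
        rw [pow_add]; nlinarith
      have h3 : 0 < -(a * b) := by linarith
      exact le_of_mul_le_mul_right (by linarith : (p : ℤ) ^ n * |m| * -(a * b) ≤ _) h3
    have hmabs : (p : ℤ) ^ (y - x) < |m| := by
      have hP : (0 : ℤ) < (p : ℤ) ^ (y - x) := by positivity
      rcases mul_neg_iff.mp hneg with ⟨h1, h2⟩ | ⟨h1, h2⟩
      · have : m ≤ |m| := le_abs_self m
        nlinarith
      · have : -m ≤ |m| := neg_le_abs m
        nlinarith
    have hlt2 : (p : ℤ) ^ (n + (y - x)) < p ^ (x + y) := by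
      rw [pow_add]; exact (mul_lt_mul_of_pos_left hmabs hpn).trans_le hprod
    have := (pow_lt_pow_iff_right₀ hp1).mp hlt2
    omega

theorem prime_pow_dvd_of_moment_relations {p n : ℕ} (hp : p.Prime) (hn : n ≠ 0)
    {A B t T : ℤ} (hA0 : A ≠ 0) (hB0 : B ≠ 0) (ht : 0 < t)
    (hABt : (p : ℤ) ^ n * t ≤ -(A * B)) (hA : A * (A - B) ∣ ((p : ℤ) ^ n) ^ 2 * t)
    (hB : B * (B - A) ∣ ((p : ℤ) ^ n) ^ 2 * t) (hT : (p : ℤ) ∣ T)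
    (hTeq : (p : ℤ) ^ n * T = (A + B) * p ^ n - A * B)
    (hg : ∀ g : ℤ, g ∣ A → g ∣ B → g ∣ (p : ℤ) ^ n) :
    (p : ℤ) ^ (n / 2 + 1) ∣ A ∧ (p : ℤ) ^ (n / 2 + 1) ∣ B := by
  obtain ⟨x, a, ha, hAx⟩ := Int.exists_eq_prime_pow_mul hp hA0
  obtain ⟨y, b, hb, hBy⟩ := Int.exists_eq_prime_pow_mul hp hB0
  have key : n / 2 + 1 ≤ x ∧ n / 2 + 1 ≤ y := by
    rcases le_total x y with hxy | hxy
    · have := prime_pow_dvd_of_moment_relations_aux hp hn ht hABt hA hB hT hTeq hg ha hb hAx hBy hxy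
      exact ⟨this, this.trans hxy⟩
    · have := prime_pow_dvd_of_moment_relations_aux hp hn ht (by linarith) hB hA hT
        (by linarith) (fun g h1 h2 => hg g h2 h1) hb ha hBy hAx hxy
      exact ⟨this.trans hxy, this⟩
  rw [hAx, hBy]
  exact ⟨(pow_dvd_pow _ key.1).mul_right _, (pow_dvd_pow _ key.2).mul_right _⟩

end Arithmetic

namespace HasWeilMoments

variable {F : Type*} [Field F] [Fintype F] {w : F → ℤ} {T : F → ℕ}

theorem sum_mul_self (H : HasWeilMoments w T) : ∑ a, w a * w a = (Fintype.card F : ℤ) ^ 2 := by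
  simpa using H.corr_self 1 one_ne_zero

theorem sum_cube (H : HasWeilMoments w T) :
    ∑ a, w a * w a * w a = (Fintype.card F : ℤ) ^ 2 * T 1 := by
  simpa [sq] using H.sum_sq_mul 1

theorem sum_sub_mul_sub (H : HasWeilMoments w T) (B C : ℤ) :
    ∑ a, (w a - B) * (w a - C)
      = (Fintype.card F : ℤ) ^ 2 - (B + C) * Fintype.card F + B * C * Fintype.card F := by
  have h : ∀ a, (w a - B) * (w a - C) = w a * w a - (B + C) * w a + B * C := fun a => by ring
  simp only [h, Finset.sum_add_distrib, Finset.sum_sub_distrib, ← Finset.mul_sum, H.sum_mul_self,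
    H.sum_eq, Finset.sum_const, nsmul_eq_mul, Finset.card_univ]
  ring

theorem sum_sub_mul_sub_mul_sub (H : HasWeilMoments w T) (A B C : ℤ) :
    ∑ a, (w a - A) * (w a - B) * (w a - C)
      = (Fintype.card F : ℤ) ^ 2 * T 1 - (A + B + C) * (Fintype.card F : ℤ) ^ 2
        + (A * B + B * C + C * A) * Fintype.card F - A * B * C * Fintype.card F := by
  have h : ∀ a, (w a - A) * (w a - B) * (w a - C)
      = w a * w a * w a - (A + B + C) * (w a * w a) + (A * B + B * C + C * A) * w a
        - A * B * C := fun a => by ring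
  simp only [h, Finset.sum_add_distrib, Finset.sum_sub_distrib, ← Finset.mul_sum, H.sum_mul_self,
    H.sum_eq, H.sum_cube, Finset.sum_const, nsmul_eq_mul, Finset.card_univ]
  ring

theorem abs_lt_of_ne (H : HasWeilMoments w T) {a b : F} (hab : a ≠ b) (hb : w b ≠ 0) :
    |w a| < Fintype.card F := by
  classical
  have h1 : w a * w a + w b * w b ≤ (Fintype.card F : ℤ) ^ 2 := by
    rw [← H.sum_mul_self, ← Finset.sum_pair hab (f := fun x => w x * w x)]
    exact Finset.sum_le_sum_of_subset_of_nonneg (Finset.subset_univ _)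
      fun x _ _ => mul_self_nonneg _
  have h2 : 0 < w b * w b := mul_self_pos.mpr hb
  refine abs_lt_of_sq_lt_sq (by nlinarith) (by positivity)

/-- An integer-valued Weil sum does not take exactly three nonzero values off zero. -/
theorem false_of_ordered_nonzero_values (H : HasWeilMoments w T) {p n : ℕ} (hp : p.Prime)
    (hcard : Fintype.card F = p ^ n) {A B C : ℤ}
    (hA0 : A ≠ 0) (hB0 : B ≠ 0) (hC0 : C ≠ 0) (hAB : A < B) (hBC : B < C)
    (hA : ∃ a, w a = A) (hB : ∃ a, w a = B) (hC : ∃ a, w a = C)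
    (hw : ∀ a, a ≠ 0 → w a = A ∨ w a = B ∨ w a = C) : False := by
  classical
  obtain ⟨a, ha⟩ := hA
  obtain ⟨b, hb⟩ := hB
  obtain ⟨c, hc⟩ := hC
  have hab : a ≠ b := by rintro rfl; omega
  have hac : a ≠ c := by rintro rfl; omega
  have hbc : b ≠ c := by rintro rfl; omega
  have hAq := H.abs_lt_of_ne hab (hb ▸ hB0)
  have hBq := H.abs_lt_of_ne hbc (hc ▸ hC0)
  have hCq := H.abs_lt_of_ne hac.symm (ha ▸ hA0)
  rw [ha] at hAq
  rw [hb] at hBq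
  rw [hc] at hCq
  have ha0 : a ≠ 0 := by rintro rfl; exact hA0 (ha ▸ H.map_zero)
  have hb0 : b ≠ 0 := by rintro rfl; exact hB0 (hb ▸ H.map_zero)
  have hc0 : c ≠ 0 := by rintro rfl; exact hC0 (hc ▸ H.map_zero)
  have hq4 : (4 : ℤ) ≤ Fintype.card F := by
    have : ({0, a, b, c} : Finset F).card = 4 := by
      rw [Finset.card_insert_of_notMem, Finset.card_insert_of_notMem,
        Finset.card_insert_of_notMem, Finset.card_singleton]
      · simpa using hbc
      · simp [hab, hac]
      · simp [ha0.symm, hb0.symm, hc0.symm]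
    have h2 := Finset.card_le_univ ({0, a, b, c} : Finset F)
    rw [this] at h2
    exact_mod_cast h2
  have hn : n ≠ 0 := by
    rintro rfl
    rw [hcard] at hq4
    norm_num at hq4
  have hcube : ∑ x, (w x - A) * (w x - B) * (w x - C) = -(A * B * C) := by
    rw [Finset.sum_eq_single 0]
    · rw [H.map_zero]; ring
    · intro x _ hx
      rcases hw x hx with h | h | h <;> rw [h] <;> ring
    · simp
  rw [H.sum_sub_mul_sub_mul_sub] at hcube
  have hqc : (Fintype.card F : ℤ) = p ^ n := by exact_mod_cast hcard
  set q : ℤ := (Fintype.card F : ℤ) with hq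
  obtain ⟨k1, k2, k3, k4, k5⟩ := two_mul_prime_pow_le_abs_mul (X := T 1 - (A + B + C)) hp hn
    hA0 hB0 hC0 (hqc ▸ hAq) (hqc ▸ hBq) (hqc ▸ hCq) (by rw [← hqc]; linear_combination -hcube)
  rw [← hqc] at k1 k2
  have off : ∀ B C : ℤ, (∀ x, x ≠ 0 → 0 ≤ (w x - B) * (w x - C)) →
      B * C ≤ q ^ 2 - (B + C) * q + B * C * q := by
    intro B C hpos
    rw [← H.sum_sub_mul_sub, ← Finset.add_sum_erase _ _ (Finset.mem_univ (0 : F)), H.map_zero]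
    have := Finset.sum_nonneg (s := Finset.univ.erase (0 : F))
      (f := fun x => (w x - B) * (w x - C)) fun x hx => hpos x (Finset.ne_of_mem_erase hx)
    linarith
  have I1 := off B C fun x hx => by
    rcases hw x hx with h | h | h <;> rw [h]
    · nlinarith
    · simp
    · simp
  have I2 := off A B fun x hx => by
    rcases hw x hx with h | h | h <;> rw [h]
    · simp
    · simp
    · nlinarith
  have hsum : ∑ x ∈ Finset.univ.erase (0 : F), w x = q := by
    rw [hq, ← H.sum_eq, ← Finset.add_sum_erase _ _ (Finset.mem_univ (0 : F)), H.map_zero, zero_add]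
  have hcardE : ((Finset.univ.erase (0 : F)).card : ℤ) = q - 1 := by
    rw [Finset.card_erase_of_mem (Finset.mem_univ _), Finset.card_univ,
      Nat.cast_sub Fintype.card_pos, hq, Nat.cast_one]
  have hAneg : A < 0 := by
    by_contra! hpos
    rw [abs_of_nonneg hpos] at k3
    have : (Finset.univ.erase (0 : F)).card • (2 : ℤ) ≤ ∑ x ∈ Finset.univ.erase (0 : F), w x :=
      Finset.card_nsmul_le_sum _ _ _ fun x hx => by
        rcases hw x (Finset.ne_of_mem_erase hx) with h | h | h <;> rw [h] <;> omega
    rw [hsum, nsmul_eq_mul, hcardE] at this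
    linarith
  have hCpos : 0 < C := by
    by_contra! hneg
    have : ∑ x ∈ Finset.univ.erase (0 : F), w x ≤ 0 := Finset.sum_nonpos fun x hx => by
      rcases hw x (Finset.ne_of_mem_erase hx) with h | h | h <;> rw [h] <;> omega
    rw [hsum] at this
    linarith
  rw [abs_of_neg hAneg] at k3 hAq
  rw [abs_of_pos hCpos] at k5 hCq
  rcases lt_or_gt_of_ne hB0 with hB | hB
  · rw [abs_of_neg hB] at k4 hBq
    rw [abs_of_neg (mul_neg_of_neg_of_pos hB hCpos)] at k2
    nlinarith
  · rw [abs_of_pos hB] at k4 hBq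
    rw [abs_of_neg (mul_neg_of_neg_of_pos hAneg hB)] at k1
    nlinarith

theorem false_of_nonzero_values (H : HasWeilMoments w T) {p n : ℕ} (hp : p.Prime)
    (hcard : Fintype.card F = p ^ n) {A B C : ℤ}
    (hA0 : A ≠ 0) (hB0 : B ≠ 0) (hC0 : C ≠ 0) (hAB : A ≠ B) (hBC : B ≠ C) (hAC : A ≠ C)
    (hA : ∃ a, w a = A) (hB : ∃ a, w a = B) (hC : ∃ a, w a = C)
    (hw : ∀ a, a ≠ 0 → w a = A ∨ w a = B ∨ w a = C) : False := by
  rcases lt_or_gt_of_ne hAB with h1 | h1 <;> rcases lt_or_gt_of_ne hBC with h2 | h2 <;>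
    rcases lt_or_gt_of_ne hAC with h3 | h3
  · exact H.false_of_ordered_nonzero_values hp hcard hA0 hB0 hC0 h1 h2 hA hB hC hw
  · omega
  · exact H.false_of_ordered_nonzero_values hp hcard hA0 hC0 hB0 h3 h2 hA hC hB
      fun a ha => by have := hw a ha; tauto
  · exact H.false_of_ordered_nonzero_values hp hcard hC0 hA0 hB0 h3 h1 hC hA hB
      fun a ha => by have := hw a ha; tauto
  · exact H.false_of_ordered_nonzero_values hp hcard hB0 hA0 hC0 h1 h3 hB hA hC
      fun a ha => by have := hw a ha; tauto
  · exact H.false_of_ordered_nonzero_values hp hcard hB0 hC0 hA0 h2 h3 hB hC hA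
      fun a ha => by have := hw a ha; tauto
  · omega
  · exact H.false_of_ordered_nonzero_values hp hcard hC0 hB0 hA0 h2 h1 hC hB hA
      fun a ha => by have := hw a ha; tauto

theorem sum_mul_shift (H : HasWeilMoments w T) {c : F} (hc0 : c ≠ 0) (hc1 : c ≠ 1) :
    ∑ a, w a * w (a * c) = 0 := by
  simpa using H.corr_ne 1 c hc0 hc1.symm

theorem sum_count_sq (H : HasWeilMoments w T) :
    (Fintype.card F : ℤ) ^ 2 * ∑ c, (T c : ℤ) ^ 2 = ∑ a, w a ^ 4 := by
  have hq : (Fintype.card F : ℤ) ^ 2 ≠ 0 := pow_ne_zero _ (by exact_mod_cast Fintype.card_ne_zero)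
  apply mul_left_cancel₀ hq
  have h1 : ∀ c, ((Fintype.card F : ℤ) ^ 2 * T c) ^ 2
      = ∑ a, ∑ b, w a ^ 2 * w b ^ 2 * (w (c * a) * w (c * b)) := by
    intro c
    rw [← H.sum_sq_mul, sq, Finset.sum_mul_sum]
    refine Finset.sum_congr rfl fun a _ => Finset.sum_congr rfl fun b _ => ?_
    rw [mul_comm c, mul_comm c]; ring
  calc (Fintype.card F : ℤ) ^ 2 * ((Fintype.card F : ℤ) ^ 2 * ∑ c, (T c : ℤ) ^ 2)
      = ∑ c, ((Fintype.card F : ℤ) ^ 2 * T c) ^ 2 := by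
        simp only [Finset.mul_sum]
        exact Finset.sum_congr rfl fun c _ => by ring
    _ = ∑ a, ∑ b, ∑ c, w a ^ 2 * w b ^ 2 * (w (c * a) * w (c * b)) := by
        simp only [h1]
        rw [Finset.sum_comm]
        exact Finset.sum_congr rfl fun a _ => Finset.sum_comm
    _ = ∑ a, (Fintype.card F : ℤ) ^ 2 * w a ^ 4 := by
        refine Finset.sum_congr rfl fun a _ => ?_
        rw [Finset.sum_eq_single a]
        · rw [← Finset.mul_sum]
          by_cases ha : a = 0
          · simp [ha, H.map_zero]
          · rw [H.corr_self a ha]; ring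
        · intro b _ hba
          rw [← Finset.mul_sum]
          by_cases hb : b = 0
          · simp [hb, H.map_zero]
          · rw [H.corr_ne a b hb hba.symm, mul_zero]
        · simp
    _ = _ := by rw [Finset.mul_sum]

/-- If an integer-valued Weil sum takes only the values `0`, `A` and `B`, then all its values are
divisible by a power of `p` exceeding the square root of the order of the field. -/
theorem prime_pow_dvd (H : HasWeilMoments w T) {p n : ℕ} (hp : p.Prime) (hn : n ≠ 0)
    (hcard : Fintype.card F = p ^ n) {A B : ℤ} (hA0 : A ≠ 0) (hB0 : B ≠ 0) (hAB : A ≠ B)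
    (hA : ∃ a, w a = A) (hB : ∃ a, w a = B) (hT : p ∣ T 1)
    (hw : ∀ a, w a = 0 ∨ w a = A ∨ w a = B) (a : F) : (p : ℤ) ^ (n / 2 + 1) ∣ w a := by
  classical
  have hA' := hA
  have hB' := hB
  obtain ⟨x, hx⟩ := hA'
  obtain ⟨y, hy⟩ := hB'
  have hxy : x ≠ y := by rintro rfl; exact hAB (hx.symm.trans hy)
  have hAq := H.abs_lt_of_ne hxy (hy ▸ hB0)
  have hBq := H.abs_lt_of_ne hxy.symm (hx ▸ hA0)
  rw [hx] at hAq
  rw [hy] at hBq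
  have hqc : (Fintype.card F : ℤ) = p ^ n := by exact_mod_cast hcard
  have hq0 : (0 : ℤ) < Fintype.card F := by exact_mod_cast Fintype.card_pos
  have e0 : ∀ x, w x * (w x - A) * (w x - B) = 0 := fun x => by
    rcases hw x with h | h | h <;> rw [h] <;> ring
  have hcub := H.sum_sub_mul_sub_mul_sub 0 A B
  simp only [sub_zero, e0, Finset.sum_const_zero] at hcub
  have h3 := H.sum_cube
  have h4 := H.sum_count_sq
  have hfour : ∑ a, w a ^ 4 = (A + B) * ∑ a, w a * w a * w a - A * B * ∑ a, w a * w a := by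
    rw [Finset.mul_sum, Finset.mul_sum, ← Finset.sum_sub_distrib]
    exact Finset.sum_congr rfl fun x _ => by linear_combination w x * e0 x
  rw [h3, H.sum_mul_self] at hfour
  rw [hfour] at h4
  set q : ℤ := (Fintype.card F : ℤ) with hq
  have hTeq : q * T 1 = (A + B) * q - A * B := by
    apply mul_left_cancel₀ hq0.ne'
    linear_combination -hcub
  have hTsq : ∑ c, (T c : ℤ) ^ 2 = (A + B) * T 1 - A * B := by
    apply mul_left_cancel₀ (pow_ne_zero 2 hq0.ne')
    linear_combination h4
  have hTsum : ∑ c, (T c : ℤ) = q := by rw [hq, ← H.sum_count]; push_cast; rfl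
  have hTne : (T 1 : ℤ) ≠ q := by
    intro h
    rw [h] at hTeq
    have : (q - A) * (q - B) = 0 := by linear_combination hTeq
    rcases mul_eq_zero.mp this with h | h
    · have := le_abs_self A; linarith
    · have := le_abs_self B; linarith
  have hzero : ∑ c ∈ Finset.univ.erase (1 : F), (T c : ℤ) * (q * T c + A * B) = 0 := by
    have h5 : ∑ c, (T c : ℤ) * (q * T c + A * B)
        = q * ∑ c, (T c : ℤ) ^ 2 + A * B * ∑ c, (T c : ℤ) := by
      rw [Finset.mul_sum, Finset.mul_sum, ← Finset.sum_add_distrib]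
      exact Finset.sum_congr rfl fun c _ => by ring
    rw [← Finset.add_sum_erase _ _ (Finset.mem_univ (1 : F)), hTsq, hTsum] at h5
    linear_combination h5 - (T 1 : ℤ) * hTeq
  obtain ⟨c, hc1, hTc, hcle⟩ : ∃ c : F, c ≠ 1 ∧ 0 < (T c : ℤ) ∧ q * T c ≤ -(A * B) := by
    by_contra! hcon
    have hterm : ∀ c ∈ Finset.univ.erase (1 : F), 0 ≤ (T c : ℤ) * (q * T c + A * B) := by
      intro c hc
      rcases (Nat.cast_nonneg (T c) : (0 : ℤ) ≤ T c).eq_or_lt with h | h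
      · rw [← h]; simp
      · have := hcon c (Finset.ne_of_mem_erase hc) h
        exact mul_nonneg h.le (by linarith)
    have hall := (Finset.sum_eq_zero_iff_of_nonneg hterm).mp hzero
    apply hTne
    rw [← hTsum, ← Finset.add_sum_erase _ _ (Finset.mem_univ (1 : F)), Finset.sum_eq_zero, add_zero]
    intro c hc
    by_contra hne
    have hpos : 0 < (T c : ℤ) := lt_of_le_of_ne (by positivity) (Ne.symm hne)
    have := hcon c (Finset.ne_of_mem_erase hc) hpos
    have := hall c hc
    nlinarith
  have hc0 : c ≠ 0 := by
    rintro rfl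
    have := H.sum_sq_mul 0
    simp only [mul_zero, H.map_zero, Finset.sum_const_zero] at this
    have h0 : 0 < q ^ 2 * (T 0 : ℤ) := by positivity
    exact h0.ne this
  have hdiv : ∀ A B : ℤ, (∀ a, w a = 0 ∨ w a = A ∨ w a = B) →
      A * (A - B) ∣ q ^ 2 * (T c : ℤ) := by
    intro A B hw
    have : q ^ 2 * (T c : ℤ) = ∑ a, w a * (w a - B) * w (a * c) := by
      have h6 : ∑ a, w a * (w a - B) * w (a * c)
          = ∑ a, w a ^ 2 * w (a * c) - B * ∑ a, w a * w (a * c) := by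
        rw [Finset.mul_sum, ← Finset.sum_sub_distrib]
        exact Finset.sum_congr rfl fun a _ => by ring
      rw [h6, H.sum_mul_shift hc0 hc1, H.sum_sq_mul]; ring
    rw [this]
    refine Finset.dvd_sum fun a _ => ?_
    rcases hw a with h | h | h <;> rw [h] <;> simp
  have hg : ∀ g : ℤ, g ∣ A → g ∣ B → g ∣ (p : ℤ) ^ n := by
    intro g hgA hgB
    rw [← hqc, hq, ← H.sum_eq]
    refine Finset.dvd_sum fun a _ => ?_
    rcases hw a with h | h | h <;> rw [h]
    · exact dvd_zero g
    · exact hgA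
    · exact hgB
  have hdA := hdiv A B hw
  have hdB := hdiv B A fun a => by have := hw a; tauto
  rw [hqc] at hdA hdB hcle hTeq
  obtain ⟨k1, k2⟩ := prime_pow_dvd_of_moment_relations hp hn hA0 hB0 hTc hcle hdA hdB
    (by exact_mod_cast hT) hTeq hg
  rcases hw a with h | h | h <;> rw [h]
  · exact dvd_zero _
  · exact k1
  · exact k2

end HasWeilMoments

/-- In a finite commutative group whose elements satisfy `g ^ p ^ m = g`, a function whose
convolution square vanishes modulo `p` vanishes modulo `p`. -/
theorem prime_dvd_of_dvd_convolution {G : Type*} [CommGroup G] [Fintype G] {p m : ℕ}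
    (hp : p.Prime) (hm : m ≠ 0) (hG : ∀ g : G, g ^ p ^ m = g) {u : G → ℤ}
    (hu : ∀ c, (p : ℤ) ∣ ∑ b, u (c * b⁻¹) * u b) (g : G) : (p : ℤ) ∣ u g := by
  classical
  have : Fact p.Prime := ⟨hp⟩
  have : CharP (MonoidAlgebra (ZMod p) G) p :=
    charP_of_injective_algebraMap (algebraMap (ZMod p) (MonoidAlgebra (ZMod p) G)).injective p
  set f : MonoidAlgebra (ZMod p) G := ∑ b, MonoidAlgebra.single b (u b : ZMod p) with hf
  have hcoef : ∀ c, f.coeff c = u c := by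
    intro c
    simp [hf, MonoidAlgebra.coeff_sum, Finsupp.finsetSum_apply, Finsupp.single_apply]
  have hsq : f * f = 0 := by
    ext c
    have : (f * f).coeff c = ((∑ b, u (c * b⁻¹) * u b : ℤ) : ZMod p) := by
      nth_rewrite 2 [hf]
      rw [Finset.mul_sum, MonoidAlgebra.coeff_sum, Finsupp.finsetSum_apply]
      push_cast
      refine Finset.sum_congr rfl fun b _ => ?_
      rw [MonoidAlgebra.coeff_mul_single_apply, hcoef]
    rw [this, (ZMod.intCast_zmod_eq_zero_iff_dvd _ p).mpr (hu c)]
    rfl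
  have hfrob : f ^ p ^ m = f := by
    rw [hf, sum_pow_char_pow]
    refine Finset.sum_congr rfl fun b _ => ?_
    rw [MonoidAlgebra.single_pow, hG, ZMod.pow_card_pow]
  have h0 : f = 0 := by
    rw [← hfrob]
    have h2 : 2 ≤ p ^ m := hp.two_le.trans (Nat.le_self_pow hm p)
    rw [← Nat.sub_add_cancel h2, pow_add, sq, hsq, mul_zero]
  have := hcoef g
  rw [h0] at this
  exact (ZMod.intCast_zmod_eq_zero_iff_dvd _ p).mp this.symm

theorem prime_pow_dvd_of_dvd_convolution {G : Type*} [CommGroup G] [Fintype G] {p m : ℕ}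
    (hp : p.Prime) (hm : m ≠ 0) (hG : ∀ g : G, g ^ p ^ m = g) (j : ℕ) {u : G → ℤ}
    (hu : ∀ c, (p : ℤ) ^ (2 * j + 1) ∣ ∑ b, u (c * b⁻¹) * u b) (g : G) :
    (p : ℤ) ^ (j + 1) ∣ u g := by
  induction j generalizing u g with
  | zero => simpa using prime_dvd_of_dvd_convolution hp hm hG (by simpa using hu) g
  | succ j ih =>
    have h1 := prime_dvd_of_dvd_convolution hp hm hG
      fun c => (dvd_pow_self (p : ℤ) (by omega)).trans (hu c)
    choose v hv using h1
    have hp0 : (p : ℤ) ≠ 0 := by exact_mod_cast hp.ne_zero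
    have h2 : ∀ c, (p : ℤ) ^ (2 * j + 1) ∣ ∑ b, v (c * b⁻¹) * v b := by
      intro c
      have h3 : ∑ b, u (c * b⁻¹) * u b = (p : ℤ) ^ 2 * ∑ b, v (c * b⁻¹) * v b := by
        rw [Finset.mul_sum]
        refine Finset.sum_congr rfl fun b _ => ?_
        rw [hv, hv b]; ring
      have h4 := hu c
      rw [h3, show 2 * (j + 1) + 1 = 2 + (2 * j + 1) by ring, pow_add] at h4
      exact (mul_dvd_mul_iff_left (pow_ne_zero 2 hp0)).mp h4
    rw [hv, pow_succ']
    exact mul_dvd_mul_left _ (ih h2 g)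

theorem sq_sub_trace_mul_add_norm {K F : Type*} [Field K] [Field F] [Finite F] [Algebra K F]
    (hF : Module.finrank K F = 2) (x : F) :
    x * x - algebraMap K F (Algebra.trace K F x) * x + algebraMap K F (Algebra.norm K x) = 0 := by
  rw [FiniteField.algebraMap_trace_eq_sum_pow, FiniteField.algebraMap_norm_eq_prod_pow, hF]
  simp only [Finset.sum_range_succ, Finset.prod_range_succ, Finset.sum_range_zero,
    Finset.prod_range_zero]
  ring

theorem norm_neg_one_of_finrank_eq_two {K F : Type*} [Field K] [Field F] [Algebra K F]
    (hF : Module.finrank K F = 2) :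
    Algebra.norm K (-1 : F) = 1 := by
  have h := Algebra.norm_algebraMap (S := F) (-1 : K)
  rw [hF] at h
  simpa using h

section QuadraticExtension

variable {K F : Type*} [Field K] [Fintype K] [Field F] [Fintype F] [Algebra K F]

theorem card_eq_sq_of_finrank_eq_two (hF : Module.finrank K F = 2) :
    Fintype.card F = Fintype.card K ^ 2 := by
  rw [Module.card_eq_pow_finrank (K := K), hF]

open Classical in
theorem card_trace_norm_fiber_add_card_le (hF : Module.finrank K F = 2) (s t : K) :
    (Finset.univ.filter fun x : F => Algebra.trace K F x = s ∧ Algebra.norm K x = t).card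
      + (Finset.univ.filter fun u : K × K => u.1 + u.2 = s ∧ u.1 * u.2 = t).card ≤ 2 := by
  set A := Finset.univ.filter fun x : F => Algebra.trace K F x = s ∧ Algebra.norm K x = t with hA
  set B := Finset.univ.filter fun u : K × K => u.1 + u.2 = s ∧ u.1 * u.2 = t with hB
  have hroot : ∀ x ∈ A, x * x - algebraMap K F s * x + algebraMap K F t = 0 := by
    intro x hx
    obtain ⟨-, rfl, rfl⟩ := Finset.mem_filter.mp hx
    exact sq_sub_trace_mul_add_norm hF x
  rcases B.eq_empty_or_nonempty with hB0 | ⟨⟨u, v⟩, huv⟩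
  · rw [hB0, Finset.card_empty, add_zero]
    rcases A.eq_empty_or_nonempty with hA0 | ⟨x, hx⟩
    · simp [hA0]
    · refine (Finset.card_le_card (t := {x, algebraMap K F s - x}) ?_).trans Finset.card_le_two
      intro y hy
      have h : (y - x) * (y - (algebraMap K F s - x)) = 0 := by
        linear_combination hroot y hy - hroot x hx
      simp only [Finset.mem_insert, Finset.mem_singleton]
      rcases mul_eq_zero.mp h with h | h
      · left; exact sub_eq_zero.mp h
      · right; exact sub_eq_zero.mp h
  · obtain ⟨-, hs, ht⟩ := Finset.mem_filter.mp huv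
    simp only at hs ht
    have hBsub : B ⊆ {(u, v), (v, u)} := by
      rintro ⟨y, z⟩ hyz
      obtain ⟨-, hs', ht'⟩ := Finset.mem_filter.mp hyz
      simp only at hs' ht'
      have h : (y - u) * (y - v) = 0 := by
        linear_combination y * hs' - ht' - y * hs + ht
      simp only [Finset.mem_insert, Finset.mem_singleton, Prod.mk.injEq]
      rcases mul_eq_zero.mp h with h | h
      · left; exact ⟨sub_eq_zero.mp h, by linear_combination hs' - hs - h⟩
      · right; exact ⟨sub_eq_zero.mp h, by linear_combination hs' - hs - h⟩
    have hAmem : ∀ x ∈ A, u = v ∧ x = algebraMap K F u := by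
      intro x hx
      have h : (x - algebraMap K F u) * (x - algebraMap K F v) = 0 := by
        have := hroot x hx
        rw [← hs, ← ht, map_add, map_mul] at this
        linear_combination this
      obtain ⟨-, hx1, hx2⟩ := Finset.mem_filter.mp hx
      have hK : ∀ z : K, x = algebraMap K F z → z + z = s := by
        rintro z rfl
        rw [Algebra.trace_algebraMap, hF, two_nsmul] at hx1
        exact hx1
      rcases mul_eq_zero.mp h with h | h
      · have := hK u (sub_eq_zero.mp h)
        exact ⟨by linear_combination this - hs, sub_eq_zero.mp h⟩
      · have := hK v (sub_eq_zero.mp h)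
        have huv : u = v := by linear_combination hs - this
        exact ⟨huv, by rw [huv]; exact sub_eq_zero.mp h⟩
    rcases A.eq_empty_or_nonempty with hA0 | ⟨x, hx⟩
    · rw [hA0, Finset.card_empty, zero_add]
      exact (Finset.card_le_card hBsub).trans Finset.card_le_two
    · have huv := (hAmem x hx).1
      have h1 : A.card ≤ 1 := Finset.card_le_one.mpr fun y hy z hz => by
        rw [(hAmem y hy).2, (hAmem z hz).2]
      have h2 : B.card ≤ 1 := by
        refine (Finset.card_le_card hBsub).trans ?_
        rw [huv, Finset.pair_eq_singleton, Finset.card_singleton]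
      omega

open Classical in
theorem card_trace_norm_fiber_add_card (hF : Module.finrank K F = 2) (s t : K) :
    (Finset.univ.filter fun x : F => Algebra.trace K F x = s ∧ Algebra.norm K x = t).card
      + (Finset.univ.filter fun u : K × K => u.1 + u.2 = s ∧ u.1 * u.2 = t).card = 2 := by
  have hsum : ∑ r : K × K,
      ((Finset.univ.filter fun x : F => Algebra.trace K F x = r.1 ∧ Algebra.norm K x = r.2).card
      + (Finset.univ.filter fun u : K × K => u.1 + u.2 = r.1 ∧ u.1 * u.2 = r.2).card)
      = ∑ _r : K × K, 2 := by
    have h1 := Finset.card_eq_sum_card_fiberwise (s := (Finset.univ : Finset F))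
      (f := fun x => (Algebra.trace K F x, Algebra.norm K x)) (t := Finset.univ)
      fun _ _ => Finset.mem_coe.mpr (Finset.mem_univ _)
    have h2 := Finset.card_eq_sum_card_fiberwise (s := (Finset.univ : Finset (K × K)))
      (f := fun u => (u.1 + u.2, u.1 * u.2)) (t := Finset.univ)
      fun _ _ => Finset.mem_coe.mpr (Finset.mem_univ _)
    simp only [Finset.card_univ, Prod.ext_iff] at h1 h2
    rw [Finset.sum_add_distrib, ← h1, ← h2, card_eq_sq_of_finrank_eq_two hF, Fintype.card_prod,
      Finset.sum_const, Finset.card_univ, Fintype.card_prod, smul_eq_mul]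
    ring
  exact (Finset.sum_eq_sum_iff_of_le fun r _ =>
    card_trace_norm_fiber_add_card_le hF r.1 r.2).mp hsum (s, t) (Finset.mem_univ _)

open Classical in
/-- The norm-restricted trace sums of `F` and of the split algebra `K × K` are opposite. -/
theorem sum_norm_fiber_trace (hF : Module.finrank K F = 2) {ψ : AddChar K ℂ} (hψ : ψ ≠ 1) (t : K) :
    ∑ x : F with Algebra.norm K x = t, ψ (Algebra.trace K F x)
      = -∑ u : K × K with u.1 * u.2 = t, ψ (u.1 + u.2) := by
  have h1 : ∑ x : F with Algebra.norm K x = t, ψ (Algebra.trace K F x)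
      = ∑ s : K, (Finset.univ.filter fun x : F =>
          Algebra.trace K F x = s ∧ Algebra.norm K x = t).card * ψ s := by
    rw [← Finset.sum_fiberwise_of_maps_to (g := fun x => Algebra.trace K F x) (t := Finset.univ)
      fun _ _ => Finset.mem_univ _]
    refine Finset.sum_congr rfl fun s _ => ?_
    rw [Finset.filter_filter, ← nsmul_eq_mul, ← Finset.sum_const]
    simp only [and_comm]
    exact Finset.sum_congr rfl fun x hx => by rw [(Finset.mem_filter.mp hx).2.2]
  have h2 : ∑ u : K × K with u.1 * u.2 = t, ψ (u.1 + u.2)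
      = ∑ s : K, (Finset.univ.filter fun u : K × K => u.1 + u.2 = s ∧ u.1 * u.2 = t).card
          * ψ s := by
    rw [← Finset.sum_fiberwise_of_maps_to (g := fun u : K × K => u.1 + u.2) (t := Finset.univ)
      fun _ _ => Finset.mem_univ _]
    refine Finset.sum_congr rfl fun s _ => ?_
    rw [Finset.filter_filter, ← nsmul_eq_mul, ← Finset.sum_const]
    simp only [and_comm]
    exact Finset.sum_congr rfl fun x hx => by rw [(Finset.mem_filter.mp hx).2.1]
  rw [eq_neg_iff_add_eq_zero, h1, h2, ← Finset.sum_add_distrib]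
  simp only [← add_mul, ← Nat.cast_add, card_trace_norm_fiber_add_card hF]
  rw [← Finset.mul_sum, AddChar.sum_eq_zero_of_ne_one hψ, mul_zero]

open Classical in
theorem card_norm_fiber (hF : Module.finrank K F = 2) (t : K) :
    (Finset.univ.filter fun x : F => Algebra.norm K x = t).card
      + (Finset.univ.filter fun u : K × K => u.1 * u.2 = t).card = 2 * Fintype.card K := by
  have h1 := Finset.card_eq_sum_card_fiberwise
    (s := (Finset.univ.filter fun x : F => Algebra.norm K x = t))
    (f := fun x => Algebra.trace K F x) (t := Finset.univ)
    fun _ _ => Finset.mem_coe.mpr (Finset.mem_univ _)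
  have h2 := Finset.card_eq_sum_card_fiberwise
    (s := (Finset.univ.filter fun u : K × K => u.1 * u.2 = t))
    (f := fun u => u.1 + u.2) (t := Finset.univ)
    fun _ _ => Finset.mem_coe.mpr (Finset.mem_univ _)
  simp only [Finset.filter_filter] at h1 h2
  rw [h1, h2, ← Finset.sum_add_distrib]
  have h3 : ∀ s : K,
      (Finset.univ.filter fun x : F => Algebra.norm K x = t ∧ Algebra.trace K F x = s).card
      + (Finset.univ.filter fun u : K × K => u.1 * u.2 = t ∧ u.1 + u.2 = s).card = 2 := by
    intro s
    rw [← card_trace_norm_fiber_add_card hF s t]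
    simp only [and_comm]
  simp only [h3, Finset.sum_const, Finset.card_univ, smul_eq_mul, mul_comm]

end QuadraticExtension

open Classical in
/-- The sum of Weil sums over a fibre of a multiplicative map depends only on the sums of the
additive character over fibres of that map. -/
theorem sum_fiber_sum_pow_sub_mul {K R : Type*} [Field K] [Fintype K] [CommRing R] [Fintype R]
    (N : R →* K) (hN : ∀ x, N x ≠ 0 → IsUnit x) (hN1 : N (-1) = 1) (χ : AddChar R ℂ) {d : ℕ}
    (hdR : Function.Injective fun x : R => x ^ d) (hdK : Function.Injective fun x : K => x ^ d)
    (c : K) :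
    ∑ a with N a = c, ∑ x with N x ≠ 0, χ (x ^ d - a * x)
      = ∑ t : K with t ≠ 0, (∑ x with N x = t ^ d, χ x) * ∑ x with N x = c * t, χ x := by
  have hinner : ∀ x, N x ≠ 0 → ∑ a with N a = c, χ (-(a * x)) = ∑ b with N b = c * N x, χ b := by
    intro x hx
    obtain ⟨y, rfl⟩ := hN x hx
    have hneg : ∀ z : R, N (-z) = N z := fun z => by rw [← neg_one_mul, map_mul, hN1, one_mul]
    refine Finset.sum_bij (fun a _ => -(a * y)) ?_ ?_ ?_ fun _ _ => rfl
    · intro a ha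
      have := (Finset.mem_filter.mp ha).2
      simp [hneg, this]
    · intro a _ b _ hab
      exact y.isUnit.mul_right_cancel (neg_injective hab)
    · intro b hb
      have := (Finset.mem_filter.mp hb).2
      refine ⟨-(b * ↑y⁻¹), ?_, by simp⟩
      have h2 : N y * N (↑y⁻¹ : R) = 1 := by rw [← map_mul]; simp
      simp only [Finset.mem_filter, Finset.mem_univ, true_and, hneg, map_mul, this]
      linear_combination c * h2
  have hpow : ∀ t : K, ∑ x with N x = t, χ (x ^ d) = ∑ x with N x = t ^ d, χ x := by
    intro t
    refine Finset.sum_bij (fun x _ => x ^ d) ?_ ?_ ?_ fun _ _ => rfl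
    · intro x hx
      have := (Finset.mem_filter.mp hx).2
      simp [this]
    · intro x _ y _ hxy
      exact hdR hxy
    · intro y hy
      have := (Finset.mem_filter.mp hy).2
      obtain ⟨x, rfl⟩ := (Finite.injective_iff_bijective.mp hdR).2 y
      refine ⟨x, ?_, rfl⟩
      simp only [map_pow] at this
      simpa using hdK this
  calc ∑ a with N a = c, ∑ x with N x ≠ 0, χ (x ^ d - a * x)
      = ∑ x with N x ≠ 0, χ (x ^ d) * ∑ b with N b = c * N x, χ b := by
        rw [Finset.sum_comm]
        refine Finset.sum_congr rfl fun x hx => ?_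
        rw [← hinner x (Finset.mem_filter.mp hx).2, Finset.mul_sum]
        refine Finset.sum_congr rfl fun a _ => ?_
        rw [sub_eq_add_neg, AddChar.map_add_eq_mul]
    _ = _ := by
        rw [← Finset.sum_fiberwise_of_maps_to (g := N) (t := Finset.univ.filter fun t : K => t ≠ 0)
          fun x hx => by simpa using hx]
        refine Finset.sum_congr rfl fun t ht => ?_
        have ht0 := (Finset.mem_filter.mp ht).2
        rw [← hpow, Finset.sum_mul, Finset.filter_filter]
        have : (Finset.univ.filter fun x => N x ≠ 0 ∧ N x = t)
            = Finset.univ.filter fun x => N x = t := by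
          refine Finset.filter_congr fun x _ => ⟨fun h => h.2, fun h => ⟨h ▸ ht0, h⟩⟩
        rw [this]
        exact Finset.sum_congr rfl fun x hx => by rw [(Finset.mem_filter.mp hx).2]

open Classical in
theorem sum_mul_eq_unit {K M : Type*} [Field K] [Fintype K] [AddCommMonoid M] (f : K → K → M)
    (c : Kˣ) :
    ∑ u : K × K with u.1 * u.2 = (c : K), f u.1 u.2 = ∑ b : Kˣ, f ↑(c * b⁻¹) b := by
  symm
  refine Finset.sum_bij (fun b _ => ((↑(c * b⁻¹) : K), (b : K))) ?_ ?_ ?_ fun _ _ => rfl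
  · intro b _
    simp
  · intro a _ b _ hab
    exact Units.ext (Prod.ext_iff.mp hab).2
  · rintro ⟨u, v⟩ huv
    have h := (Finset.mem_filter.mp huv).2
    simp only at h
    have hv : v ≠ 0 := by
      rintro rfl
      rw [mul_zero] at h
      exact c.ne_zero h.symm
    refine ⟨Units.mk0 v hv, Finset.mem_univ _, ?_⟩
    simp [← h, hv]

theorem sum_ne_zero_eq_powSum_sub_one {F : Type*} [Field F] [Fintype F] [DecidableEq F]
    (ψ : AddChar F ℂ) {d : ℕ} (hd : Function.Injective fun x : F => x ^ d) (a : F) :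
    ∑ x : F with x ≠ 0, ψ (x ^ d - a * x) = powSum ψ d a - 1 := by
  rw [powSum, eq_sub_iff_add_eq, ← Finset.sum_filter_add_sum_filter_not Finset.univ
    (fun x : F => x ≠ 0) (fun x => ψ (x ^ d - a * x))]
  simp [Finset.filter_eq', zero_pow_of_injective hd]

/-- The lift of an additive character to an extension along the trace. -/
noncomputable def traceLift (F : Type*) {K : Type*} [Field K] [Field F] [Algebra K F]
    (ψ : AddChar K ℂ) : AddChar F ℂ :=
  ψ.compAddMonoidHom (Algebra.trace K F).toAddMonoidHom

theorem traceLift_apply {K F : Type*} [Field K] [Field F] [Algebra K F] (ψ : AddChar K ℂ) (x : F) :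
    traceLift F ψ x = ψ (Algebra.trace K F x) := rfl

section QuadraticExtension

variable {K F : Type*} [Field K] [Fintype K] [Field F] [Fintype F] [Algebra K F]

open Classical in
theorem sum_norm_fiber_powSum_sub_one (hF : Module.finrank K F = 2) {ψ : AddChar K ℂ}
    (hψ : ψ ≠ 1) {d : ℕ} (hdF : Function.Injective fun x : F => x ^ d)
    (hdK : Function.Injective fun x : K => x ^ d) (c : Kˣ) :
    ∑ a : F with Algebra.norm K a = c, (powSum (traceLift F ψ) d a - 1)
      = ∑ b : Kˣ, (powSum ψ d ↑(c * b⁻¹) - 1) * (powSum ψ d b - 1) := by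
  have h1 := sum_fiber_sum_pow_sub_mul (Algebra.norm K : F →* K)
    (fun x hx => (Algebra.norm_ne_zero_iff.mp hx).isUnit) (norm_neg_one_of_finrank_eq_two hF)
    (traceLift F ψ) hdF hdK c
  let χ : AddChar (K × K) ℂ := ψ.compAddMonoidHom
    ((AddMonoidHom.id K).coprod (AddMonoidHom.id K))
  have hχ : ∀ u : K × K, χ u = ψ (u.1 + u.2) := fun _ => rfl
  have hN : ∀ u : K × K, (mulMonoidHom : K × K →* K) u = u.1 * u.2 := fun _ => rfl
  have h2 := sum_fiber_sum_pow_sub_mul (mulMonoidHom : K × K →* K)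
    (fun x hx => by
      rw [hN] at hx
      exact Prod.isUnit_iff.mpr ⟨(left_ne_zero_of_mul hx).isUnit, (right_ne_zero_of_mul hx).isUnit⟩)
    (by simp) χ (d := d)
    (fun x y hxy => Prod.ext (hdK (Prod.ext_iff.mp hxy).1) (hdK (Prod.ext_iff.mp hxy).2)) hdK c
  have h3 : ∑ a : F with Algebra.norm K a = c, (powSum (traceLift F ψ) d a - 1)
      = ∑ u : K × K with u.1 * u.2 = (c : K), (powSum ψ d u.1 - 1) * (powSum ψ d u.2 - 1) := by
    calc _ = ∑ a : F with Algebra.norm K a = c, ∑ x : F with Algebra.norm K x ≠ 0,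
          traceLift F ψ (x ^ d - a * x) := by
          simp only [Algebra.norm_ne_zero_iff, sum_ne_zero_eq_powSum_sub_one _ hdF]
      _ = _ := h1
      _ = _ := by
          simp only [hN, hχ] at h2
          simp only [traceLift_apply, sum_norm_fiber_trace hF hψ, neg_mul_neg]
          rw [← h2]
          refine Finset.sum_congr rfl fun u _ => ?_
          rw [← sum_ne_zero_eq_powSum_sub_one _ hdK, ← sum_ne_zero_eq_powSum_sub_one _ hdK,
            Finset.sum_mul_sum, ← Finset.sum_product']
          refine Finset.sum_congr ?_ fun x _ => ?_
          · ext x; simp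
          · rw [← AddChar.map_add_eq_mul]; rfl
  rw [h3, sum_mul_eq_unit (fun x y => (powSum ψ d x - 1) * (powSum ψ d y - 1))]

open Classical in
/-- The sum of a Weil sum over a norm fibre is the multiplicative convolution square of the Weil
sum on the quadratic subfield. -/
theorem sum_norm_fiber_powSum (hF : Module.finrank K F = 2) {ψ : AddChar K ℂ}
    (hψ : ψ ≠ 1) {d : ℕ} (hdF : Function.Injective fun x : F => x ^ d)
    (hdK : Function.Injective fun x : K => x ^ d) (c : Kˣ) :
    ∑ a : F with Algebra.norm K a = c, powSum (traceLift F ψ) d a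
      = ∑ b : Kˣ, powSum ψ d ↑(c * b⁻¹) * powSum ψ d b := by
  have h := sum_norm_fiber_powSum_sub_one hF hψ hdF hdK c
  have hunits : ∑ b : Kˣ, powSum ψ d b = Fintype.card K := by
    have h1 := sum_powSum hψ hdK
    rw [← Finset.add_sum_erase _ _ (Finset.mem_univ (0 : K)), powSum_zero hψ hdK, zero_add] at h1
    rw [← h1]
    refine Finset.sum_bij (fun b _ => (b : K)) ?_ ?_ ?_ fun _ _ => rfl
    · intro b _; simp
    · intro a _ b _ hab; exact Units.ext hab
    · intro b hb; exact ⟨Units.mk0 b (Finset.ne_of_mem_erase hb), Finset.mem_univ _, rfl⟩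
  have hunits' : ∑ b : Kˣ, powSum ψ d ↑(c * b⁻¹) = Fintype.card K := by
    rw [← hunits]
    simpa [div_eq_mul_inv] using (Equiv.divLeft c).sum_comp (fun b : Kˣ => powSum ψ d b)
  have hcard := card_norm_fiber hF (c : K)
  have hK := sum_mul_eq_unit (fun _ _ => 1) c
  rw [Finset.sum_const, Finset.sum_const, smul_eq_mul, smul_eq_mul, mul_one, mul_one,
    Finset.card_univ] at hK
  rw [hK] at hcard
  have hexp : ∀ b : Kˣ, (powSum ψ d ↑(c * b⁻¹) - 1) * (powSum ψ d b - 1)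
      = powSum ψ d ↑(c * b⁻¹) * powSum ψ d b - powSum ψ d ↑(c * b⁻¹) - powSum ψ d b + 1 :=
    fun b => by ring
  simp only [hexp, Finset.sum_add_distrib, Finset.sum_sub_distrib, hunits, hunits',
    Finset.sum_const, nsmul_eq_mul, mul_one, Finset.card_univ] at h
  have hcard' : ((Finset.univ.filter fun x : F => Algebra.norm K x = c).card : ℂ)
      + Fintype.card Kˣ = 2 * Fintype.card K := by exact_mod_cast hcard
  linear_combination h + hcard'

theorem exists_not_prime_pow_dvd (hF : Module.finrank K F = 2) {ψ : AddChar K ℂ}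
    (hψ : ψ ≠ 1) {d : ℕ} (hdF : Function.Injective fun x : F => x ^ d)
    (hdK : Function.Injective fun x : K => x ^ d) {p m j : ℕ} (hp : p.Prime) (hm : m ≠ 0)
    (hcard : Fintype.card K = p ^ m) {v : K → ℤ} (hv : ∀ a, (v a : ℂ) = powSum ψ d a)
    {w : F → ℤ} (hw : ∀ a, (w a : ℂ) = powSum (traceLift F ψ) d a)
    (h : ∃ a, a ≠ 0 ∧ ¬ (p : ℤ) ^ (j + 1) ∣ v a) :
    ∃ a, a ≠ 0 ∧ ¬ (p : ℤ) ^ (2 * j + 1) ∣ w a := by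
  classical
  by_contra! hall
  obtain ⟨a, ha, hva⟩ := h
  apply hva
  have hG : ∀ g : Kˣ, g ^ p ^ m = g := fun g => by
    rw [← hcard]
    exact Units.ext (by simp [FiniteField.pow_card])
  refine prime_pow_dvd_of_dvd_convolution (u := fun b : Kˣ => v b) hp hm hG j (fun c => ?_)
    (Units.mk0 a ha)
  have hid := sum_norm_fiber_powSum hF hψ hdF hdK c
  simp only [← hv, ← hw] at hid
  have hid' : ∑ a : F with Algebra.norm K a = c, w a = ∑ b : Kˣ, v ↑(c * b⁻¹) * v b := by
    exact_mod_cast hid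
  rw [← hid']
  refine Finset.dvd_sum fun x hx => hall x ?_
  rintro rfl
  have := (Finset.mem_filter.mp hx).2
  rw [Algebra.norm_zero] at this
  exact c.ne_zero this.symm

/-- If the Weil sum on the quadratic subfield is degenerate, then the Weil sum on the large field
is bounded below by minus the order of the subfield. -/
theorem neg_card_le_of_isDegenerate {ψ : AddChar K ℂ}
    (hψ : ψ ≠ 1) {d : ℕ} (hdF : Function.Injective fun x : F => x ^ d)
    (hdK : Function.Injective fun x : K => x ^ d) (hF : Module.finrank K F = 2)
    (hdeg : IsDegenerate ψ d) {w : F → ℤ} (hw : ∀ a, (w a : ℂ) = powSum (traceLift F ψ) d a)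
    (a : F) : -(Fintype.card K : ℤ) ≤ w a := by
  classical
  obtain ⟨a₀, ha₀, hdeg⟩ := hdeg
  have hexp : ∀ x : F, ∃ σ : K, ∀ y : K, traceLift F ψ ((algebraMap K F y * x) ^ d
      - a * (algebraMap K F y * x)) = ψ (y * (a₀ * σ - Algebra.trace K F (a * x))) := by
    intro x
    obtain ⟨σ, hσ⟩ := (Finite.injective_iff_bijective.mp hdK).2 (Algebra.trace K F (x ^ d))
    simp only at hσ
    refine ⟨σ, fun y => ?_⟩
    have h1 : (algebraMap K F y * x) ^ d - a * (algebraMap K F y * x)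
        = y ^ d • x ^ d - y • (a * x) := by
      rw [Algebra.smul_def, Algebra.smul_def, mul_pow, map_pow]; ring
    rw [h1, traceLift_apply, map_sub, map_smul, map_smul, smul_eq_mul, smul_eq_mul, ← hσ, ← mul_pow,
      sub_eq_add_neg, AddChar.map_add_eq_mul, hdeg, ← AddChar.map_add_eq_mul]
    congr 1; ring
  have hinner : ∀ x : F, ∃ n : ℕ, ∑ y : K, traceLift F ψ ((algebraMap K F y * x) ^ d
      - a * (algebraMap K F y * x)) = Fintype.card K * n := by
    intro x
    obtain ⟨σ, hσ⟩ := hexp x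
    simp only [hσ, AddChar.sum_mul_eq_ite hψ]
    split_ifs
    · exact ⟨1, by simp⟩
    · exact ⟨0, by simp⟩
  choose n hn using hinner
  have hn0 : n 0 = 1 := by
    have := hn 0
    simp only [mul_zero, zero_pow_of_injective hdF, sub_zero, AddChar.map_zero_eq_one,
      Finset.sum_const, nsmul_eq_mul, mul_one, Finset.card_univ] at this
    have h2 : Fintype.card K * 1 = Fintype.card K * n 0 := by
      rw [mul_one]; exact_mod_cast this
    exact (Nat.eq_of_mul_eq_mul_left Fintype.card_pos h2).symm
  have hshift : ∀ y : K, y ≠ 0 → ∑ x : F, traceLift F ψ ((algebraMap K F y * x) ^ d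
      - a * (algebraMap K F y * x)) = powSum (traceLift F ψ) d a := by
    intro y hy
    exact Equiv.sum_comp (Equiv.mulLeft₀ (algebraMap K F y) (by simpa using hy))
      (fun x => traceLift F ψ (x ^ d - a * x))
  have htotal : ∑ y : K, ∑ x : F, traceLift F ψ ((algebraMap K F y * x) ^ d
      - a * (algebraMap K F y * x)) = Fintype.card K * ((∑ x, n x : ℕ) : ℂ) := by
    rw [Finset.sum_comm, Nat.cast_sum, Finset.mul_sum]
    exact Finset.sum_congr rfl fun x _ => hn x
  rw [← Finset.add_sum_erase _ _ (Finset.mem_univ (0 : K)),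
    Finset.sum_congr rfl fun y hy => hshift y (Finset.ne_of_mem_erase hy)] at htotal
  simp only [map_zero, zero_mul, mul_zero, zero_pow_of_injective hdF, sub_zero,
    AddChar.map_zero_eq_one, Finset.sum_const, nsmul_eq_mul, mul_one, Finset.card_univ,
    Finset.card_erase_of_mem (Finset.mem_univ (0 : K)), ← hw,
    card_eq_sq_of_finrank_eq_two hF, Nat.cast_sub Fintype.card_pos] at htotal
  have hint : (Fintype.card K : ℤ) ^ 2 + (Fintype.card K - 1) * w a
      = Fintype.card K * (∑ x, n x : ℕ) := by
    exact_mod_cast htotal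
  have hle : (1 : ℤ) ≤ (∑ x, n x : ℕ) := by
    have : n 0 ≤ ∑ x, n x := Finset.single_le_sum (fun _ _ => Nat.zero_le _) (Finset.mem_univ 0)
    rw [hn0] at this
    exact_mod_cast this
  have hQ : (1 : ℤ) < Fintype.card K := by exact_mod_cast Fintype.one_lt_card
  nlinarith

end QuadraticExtension

theorem traceLift_ne_one {K F : Type*} [Field K] [Field F] [Finite K] [Finite F] [Algebra K F]
    {ψ : AddChar K ℂ} (hψ : ψ ≠ 1) : traceLift F ψ ≠ 1 := by
  obtain ⟨x, hx⟩ := AddChar.ne_one_iff.mp hψ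
  obtain ⟨y, rfl⟩ := Algebra.trace_surjective K F x
  exact AddChar.ne_one_iff.mpr ⟨y, hx⟩

theorem traceLift_traceLift {k K F : Type*} [Field k] [Field K] [Field F] [Finite F]
    [Algebra k K] [Algebra k F] [Algebra K F] [IsScalarTower k K F] (ψ : AddChar k ℂ) :
    traceLift F (traceLift K ψ) = traceLift F ψ := by
  ext x
  have : Finite K := Finite.of_injective _ (algebraMap K F).injective
  have : Finite k := Finite.of_injective _ (algebraMap k K).injective
  simp only [traceLift_apply, Algebra.trace_trace]

theorem pow_injective_of_injective {K F : Type*} [Field K] [Field F] [Algebra K F] {d : ℕ}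
    (hd : Function.Injective fun x : F => x ^ d) : Function.Injective fun x : K => x ^ d := by
  intro x y hxy
  apply (algebraMap K F).injective
  apply hd
  simp only at hxy ⊢
  rw [← map_pow, hxy, map_pow]

theorem isDegenerate_of_card_eq {F : Type*} [Field F] [Fintype F] {p : ℕ} (hp : p = 2 ∨ p = 3)
    (hcard : Fintype.card F = p) (ψ : AddChar F ℂ) {d : ℕ}
    (hd : Function.Injective fun x : F => x ^ d) : IsDegenerate ψ d := by
  refine ⟨1, one_ne_zero, fun x => ?_⟩
  rw [one_mul]
  have hx : x ^ p = x := hcard ▸ FiniteField.pow_card x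
  have h3 : x = 0 ∨ x = 1 ∨ x = -1 := by
    rcases hp with rfl | rfl
    · have : x * (x - 1) = 0 := by linear_combination hx
      rcases mul_eq_zero.mp this with h | h
      · exact Or.inl h
      · exact Or.inr (Or.inl (sub_eq_zero.mp h))
    · have : x * ((x - 1) * (x + 1)) = 0 := by linear_combination hx
      rcases mul_eq_zero.mp this with h | h
      · exact Or.inl h
      · rcases mul_eq_zero.mp h with h | h
        · exact Or.inr (Or.inl (sub_eq_zero.mp h))
        · exact Or.inr (Or.inr (eq_neg_of_add_eq_zero_left h))
  rcases h3 with rfl | rfl | rfl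
  · rw [zero_pow_of_injective hd]
  · rw [one_pow]
  · rw [neg_pow_of_injective hd, one_pow]

theorem FiniteField.exists_intermediateField_finrank_eq_two {p m : ℕ} [Fact p.Prime] (hm : m ≠ 0)
    {F : Type*} [Field F] [Fintype F] [Algebra (ZMod p) F] (hcard : Fintype.card F = p ^ (2 * m)) :
    ∃ K : IntermediateField (ZMod p) F, Nat.card K = p ^ m ∧ Module.finrank K F = 2 := by
  have hp : p.Prime := Fact.out
  have hfin : Module.finrank (ZMod p) F = 2 * m := by
    have h := Module.card_eq_pow_finrank (K := ZMod p) (V := F)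
    rw [hcard, ZMod.card] at h
    exact (Nat.pow_right_injective hp.two_le h).symm
  obtain ⟨f⟩ := FiniteField.nonempty_algHom_of_finrank_dvd (F := ZMod p) (K := GaloisField p m)
    (L := F) (by rw [GaloisField.finrank p hm, hfin]; exact Dvd.intro_left 2 rfl)
  refine ⟨f.fieldRange, ?_, ?_⟩
  · rw [← GaloisField.card p m hm]
    exact (Nat.card_congr (AlgEquiv.ofInjectiveField f).toEquiv).symm
  · have h1 : Module.finrank (ZMod p) f.fieldRange = m :=
      (AlgEquiv.ofInjectiveField f).toLinearEquiv.finrank_eq.symm.trans (GaloisField.finrank p hm)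
    have h2 := Module.finrank_mul_finrank (ZMod p) f.fieldRange F
    rw [h1, hfin, mul_comm 2] at h2
    exact Nat.eq_of_mul_eq_mul_left (Nat.pos_of_ne_zero hm) h2

/-- On a field of order `p ^ 2 ^ i`, a nondegenerate Weil sum takes a value whose `p`-adic
valuation is at most that of the square root of the order of the field. -/
theorem isDegenerate_or_exists_not_prime_pow_dvd {p : ℕ} [Fact p.Prime] (hp : p = 2 ∨ p = 3)
    (i : ℕ) {F : Type*} [Field F] [Fintype F] [Algebra (ZMod p) F]
    (hcard : Fintype.card F = p ^ 2 ^ i) {d : ℕ} (hd : Function.Injective fun x : F => x ^ d)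
    {w : F → ℤ} (hw : ∀ a, (w a : ℂ) = powSum (traceLift F (ZMod.stdAddChar (N := p))) d a) :
    IsDegenerate (traceLift F (ZMod.stdAddChar (N := p))) d ∨
      ∃ a, a ≠ 0 ∧ ¬ (p : ℤ) ^ (2 ^ i / 2 + 1) ∣ w a := by
  have hprime : p.Prime := Fact.out
  have hstd : ZMod.stdAddChar (N := p) ≠ 1 := by
    intro h
    have h1 := ZMod.injective_stdAddChar (N := p) (a₁ := 0) (a₂ := 1) (by rw [h]; rfl)
    exact zero_ne_one h1
  induction i generalizing F with
  | zero => exact Or.inl (isDegenerate_of_card_eq hp (by simpa using hcard) _ hd)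
  | succ i ih =>
    rw [show 2 ^ (i + 1) / 2 = 2 ^ i by rw [pow_succ', Nat.mul_div_cancel_left _ two_pos]]
    rw [pow_succ'] at hcard
    obtain ⟨K, hK, hKF⟩ :=
      FiniteField.exists_intermediateField_finrank_eq_two (pow_ne_zero i two_ne_zero) hcard
    have : Fintype K := Fintype.ofFinite K
    rw [Nat.card_eq_fintype_card] at hK
    have : CharP K p := charP_of_injective_algebraMap (algebraMap (ZMod p) K).injective p
    have hdK : Function.Injective fun x : K => x ^ d := pow_injective_of_injective hd
    obtain ⟨v, hv⟩ := exists_int_cast_eq_powSum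
      (ψ := traceLift K (ZMod.stdAddChar (N := p))) hp hdK
    have hψK : traceLift K (ZMod.stdAddChar (N := p)) ≠ 1 := traceLift_ne_one hstd
    have hψF : traceLift F (ZMod.stdAddChar (N := p)) ≠ 1 := traceLift_ne_one hstd
    have hw' := hw
    rw [← traceLift_traceLift (K := K)] at hw'
    rcases ih hK hdK hv with hdeg | hnd
    · by_contra! hcon
      obtain ⟨hcon, hall⟩ := hcon
      refine hcon (isDegenerate_of_nonneg hψF hd hw fun a => ?_)
      by_cases ha : a = 0
      · rw [ha, (hasWeilMoments_of_cast_eq hψF hd hw).map_zero]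
      · have h1 := neg_card_le_of_isDegenerate hψK hd hdK hKF hdeg hw' a
        have h2 : (Fintype.card K : ℤ) = p ^ 2 ^ i := by exact_mod_cast hK
        by_contra! hneg
        have h3 := Int.le_of_dvd (neg_pos.mpr hneg) ((dvd_neg).mpr (hall a ha))
        have h4 : (p : ℤ) ^ 2 ^ i < p ^ (2 ^ i + 1) :=
          pow_lt_pow_right₀ (by exact_mod_cast hprime.one_lt) (Nat.lt_succ_self _)
        rw [h2] at h1
        linarith
    · obtain ⟨a, ha, hwa⟩ := exists_not_prime_pow_dvd hKF hψK hd hdK hprime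
        (pow_ne_zero i two_ne_zero) hK hv hw' hnd
      refine Or.inr ⟨a, ha, fun h => hwa ((pow_dvd_pow _ ?_).trans h)⟩
      omega

theorem pow_injective_of_coprime {F : Type*} [Field F] [Fintype F] {d : ℕ} (hd0 : 0 < d)
    (hd : Nat.gcd d (Fintype.card F - 1) = 1) : Function.Injective fun x : F => x ^ d := by
  classical
  intro x y hxy
  simp only at hxy
  by_cases hx : x = 0
  · subst hx
    rw [zero_pow hd0.ne'] at hxy
    exact (pow_eq_zero_iff hd0.ne').mp hxy.symm |>.symm
  · have hy : y ≠ 0 := by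
      rintro rfl
      rw [zero_pow hd0.ne'] at hxy
      exact hx ((pow_eq_zero_iff hd0.ne').mp hxy)
    have hcop : (Nat.card Fˣ).Coprime d := by
      rw [Nat.card_eq_fintype_card, Fintype.card_units]
      exact (Nat.Coprime.symm hd)
    have h : Units.mk0 x hx = Units.mk0 y hy :=
      (powCoprime hcop).injective (Units.ext (by simpa using hxy))
    simpa using congrArg Units.val h

theorem weilSum_eq_powSum (F : Type*) [Field F] [Fintype F] (p : ℕ) [Fact p.Prime] [CharP F p]
    (d : ℕ) (a : F) :
    letI : Algebra (ZMod p) F := ZMod.algebra F p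
    weilSum F p d a = powSum (traceLift F (ZMod.stdAddChar (N := p))) d a := by
  letI : Algebra (ZMod p) F := ZMod.algebra F p
  refine Finset.sum_congr rfl fun x _ => ?_
  rw [canonicalPsi, traceLift_apply]
  set t := Algebra.trace (ZMod p) F (x ^ d - a * x)
  have h := ZMod.stdAddChar_coe (N := p) t.val
  rw [Int.cast_natCast, ZMod.natCast_zmod_val] at h
  rw [h]
  simp

/-- Helleseth's three-valued conjecture in characteristics 2 and 3: if `p ∈ {2,3}` and
`[F:𝔽_p]` is a power of `2`, then no invertible exponent `d` yields a three-valued `W_{F,d}`. -/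
theorem no_three_valued_weilSum_char_two_three (F : Type*) [Field F] [Fintype F]
    (p : ℕ) [Fact p.Prime] [CharP F p] (hp : p = 2 ∨ p = 3)
    (n s : ℕ) (hn : n = 2 ^ s) (hcard : Fintype.card F = p ^ n) :
    ∀ d : ℕ, 0 < d → Nat.gcd d (Fintype.card F - 1) = 1 →
      Set.ncard {w : ℂ | ∃ a : F, a ≠ 0 ∧ weilSum F p d a = w} ≠ 3 := by
  intro d hd0 hgcd hthree
  letI : Algebra (ZMod p) F := ZMod.algebra F p
  have hprime : p.Prime := Fact.out
  have hd := pow_injective_of_coprime hd0 hgcd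
  obtain ⟨w, hw⟩ := exists_int_cast_eq_powSum
    (ψ := traceLift F (ZMod.stdAddChar (N := p))) hp hd
  have hψ : traceLift F (ZMod.stdAddChar (N := p)) ≠ 1 := traceLift_ne_one fun h =>
    zero_ne_one (ZMod.injective_stdAddChar (N := p) (a₁ := 0) (a₂ := 1) (by rw [h]; rfl))
  have H := hasWeilMoments_of_cast_eq hψ hd hw
  simp only [weilSum_eq_powSum, ← hw] at hthree
  obtain ⟨x, y, z, hxy, hxz, hyz, hset⟩ := Set.ncard_eq_three.mp hthree
  obtain ⟨a, ha, rfl⟩ : x ∈ {v : ℂ | ∃ a : F, a ≠ 0 ∧ (w a : ℂ) = v} := by rw [hset]; simp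
  obtain ⟨b, hb, rfl⟩ : y ∈ {v : ℂ | ∃ a : F, a ≠ 0 ∧ (w a : ℂ) = v} := by rw [hset]; simp
  obtain ⟨c, hc, rfl⟩ : z ∈ {v : ℂ | ∃ a : F, a ≠ 0 ∧ (w a : ℂ) = v} := by rw [hset]; simp
  have hval : ∀ t, t ≠ 0 → w t = w a ∨ w t = w b ∨ w t = w c := by
    intro t ht
    have : (w t : ℂ) ∈ {v : ℂ | ∃ a : F, a ≠ 0 ∧ (w a : ℂ) = v} := ⟨t, ht, rfl⟩
    rw [hset] at this
    simpa using this
  rw [Ne, Int.cast_inj] at hxy hxz hyz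
  have hT : p ∣ fiberCount d (1 : F) := by
    rcases hp with rfl | rfl
    · exact two_dvd_fiberCount_one
    · exact three_dvd_fiberCount_one hd
  have hn0 : n ≠ 0 := hn ▸ pow_ne_zero s two_ne_zero
  have hdvd : ∀ t, (p : ℤ) ^ (n / 2 + 1) ∣ w t := by
    have key : ∀ a b c : F, w a = 0 → w a ≠ w b → w a ≠ w c → w b ≠ w c →
        (∀ t, t ≠ 0 → w t = w a ∨ w t = w b ∨ w t = w c) →
        ∀ t, (p : ℤ) ^ (n / 2 + 1) ∣ w t := by
      intro a b c h0 hab hac hbc hval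
      rw [h0] at hab hac hval
      refine H.prime_pow_dvd hprime hn0 hcard hab.symm hac.symm hbc ⟨b, rfl⟩ ⟨c, rfl⟩ hT
        fun t => ?_
      by_cases ht : t = 0
      · exact Or.inl (ht ▸ H.map_zero)
      · exact hval t ht
    by_cases h1 : w a = 0
    · exact key a b c h1 hxy hxz hyz hval
    by_cases h2 : w b = 0
    · exact key b a c h2 (Ne.symm hxy) hyz hxz fun t ht => by have := hval t ht; tauto
    by_cases h3 : w c = 0
    · exact key c a b h3 (Ne.symm hxz) (Ne.symm hyz) hxy fun t ht => by have := hval t ht; tauto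
    exact (H.false_of_nonzero_values hprime hcard h1 h2 h3 hxy hyz hxz ⟨a, rfl⟩ ⟨b, rfl⟩
      ⟨c, rfl⟩ hval).elim
  subst hn
  rcases isDegenerate_or_exists_not_prime_pow_dvd hp s hcard hd hw with hdeg | ⟨t, -, ht⟩
  · have htwo : ∀ t, w t = 0 ∨ w t = Fintype.card F := by
      intro t
      have := powSum_of_isDegenerate hψ hdeg t
      rw [← hw] at this
      exact_mod_cast this
    have h1 := htwo a
    have h2 := htwo b
    have h3 := htwo c
    omega
  · exact ht (hdvd t)
end
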